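/- (Schmüdgen's positivstellensatz) Let a_1,...,a_m ∈ ℝ[X] with S := {a_1 ≥ 0,...,a_m ≥ 0} nonempty and bounded (hence compact). Then every f ∈ ℝ[X] strictly positive on S belongs to the preordering P(a) generated by a_1,...,a_m. -/

import Mathlib

open Finset MvPolynomial

/-- `p` is a sum of squares. -/
def IsSOS {d : ℕ} (p : MvPolynomial (Fin d) ℝ) : Prop :=
  ∃ (k : ℕ) (q : Fin k → MvPolynomial (Fin d) ℝ), p = ∑ j, q j ^ 2

/-- The preordering generated by `a : Fin m → ℝ[X]`: all sums of terms
`σ_T · ∏_{i ∈ T} a_i` with each `σ_T` a sum of squares. -/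
def Preordering {d m : ℕ} (a : Fin m → MvPolynomial (Fin d) ℝ) :
    Set (MvPolynomial (Fin d) ℝ) :=
  {f | ∃ σ : Finset (Fin m) → MvPolynomial (Fin d) ℝ,
        (∀ T, IsSOS (σ T)) ∧ f = ∑ T : Finset (Fin m), σ T * ∏ i ∈ T, a i}


def IVTField (R : Type) [Field R] [LinearOrder R] : Prop :=
  ∀ (p : Polynomial R) (a b : R), a < b → p.eval a * p.eval b < 0 →
    ∃ c, a < c ∧ c < b ∧ p.eval c = 0

theorem exists_factor_root {R : Type} [Field R] (p : Polynomial R) (hp : p ≠ 0) (a : R)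
    (ha : p.eval a = 0) : ∃ (m : ℕ) (q : Polynomial R),
      p = (Polynomial.X - Polynomial.C a) ^ (m + 1) * q ∧ q.eval a ≠ 0 := by
  obtain ⟨q, hq, hd⟩ := Polynomial.exists_eq_pow_rootMultiplicity_mul_and_not_dvd p hp a
  have hpos : 0 < p.rootMultiplicity a := (Polynomial.rootMultiplicity_pos hp).2 ha
  obtain ⟨m, hm⟩ := Nat.exists_eq_succ_of_ne_zero hpos.ne'
  refine ⟨m, q, ?_, ?_⟩
  · rw [hm] at hq; exact hq
  · intro h; exact hd (Polynomial.dvd_iff_isRoot.2 h)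

theorem ivt_rolle {R : Type} [Field R] [LinearOrder R] [IsStrictOrderedRing R] (h : IVTField R)
    (p : Polynomial R) (a b : R) (hab : a < b) (ha : p.eval a = 0) (hb : p.eval b = 0) :
    ∃ c, a < c ∧ c < b ∧ p.derivative.eval c = 0 := by
  by_cases hp : p = 0
  · obtain ⟨c, h1, h2⟩ := exists_between hab
    exact ⟨c, h1, h2, by simp [hp]⟩
  -- choose the minimal root above a
  let S := p.roots.toFinset.filter (fun x => a < x)
  have hbS : b ∈ S := by simp [S, hp, hab, hb]
  have hne : S.Nonempty := ⟨b, hbS⟩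
  set b' := S.min' hne with hb'
  have hb'S : b' ∈ S := S.min'_mem hne
  have hb'b : b' ≤ b := S.min'_le b hbS
  have hab' : a < b' := (Finset.mem_filter.1 hb'S).2
  have hrb' : p.eval b' = 0 := by
    have := (Finset.mem_filter.1 hb'S).1
    simpa [hp] using this
  have hno : ∀ c, a < c → c < b' → p.eval c ≠ 0 := by
    intro c h1 h2 h3
    have : c ∈ S := by simp [S, hp, h1, h3]
    exact absurd (S.min'_le c this) (not_le.2 h2)
  obtain ⟨m, p1, hp1, hp1a⟩ := exists_factor_root p hp a ha
  have hp10 : p1 ≠ 0 := by rintro rfl; simp at hp1a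
  have hp1b : p1.eval b' = 0 := by
    rw [hp1] at hrb'
    simp only [Polynomial.eval_mul, Polynomial.eval_pow, Polynomial.eval_sub, Polynomial.eval_X,
      Polynomial.eval_C, mul_eq_zero] at hrb'
    rcases hrb' with h | h
    · exact absurd (pow_eq_zero_iff (by omega) |>.1 h) (sub_pos.2 hab').ne'
    · exact h
  obtain ⟨k, q, hq, hqb⟩ := exists_factor_root p1 hp10 b' hp1b
  have hqa : q.eval a ≠ 0 := by
    intro h0; apply hp1a; rw [hq]; simp [h0]
  have hqq : 0 < q.eval a * q.eval b' := by
    rcases lt_trichotomy (q.eval a * q.eval b') 0 with h1 | h1 | h1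
    · obtain ⟨c, c1, c2, c3⟩ := h q a b' hab' h1
      exact absurd (by rw [hp1, hq]; simp [c3]) (hno c c1 c2)
    · exact absurd h1 (mul_ne_zero hqa hqb)
    · exact h1
  let X : Polynomial R := Polynomial.X
  let r : Polynomial R := (m + 1) * (X - Polynomial.C b') * q + (k + 1) * (X - Polynomial.C a) * q
    + (X - Polynomial.C a) * (X - Polynomial.C b') * q.derivative
  have hd : p.derivative = (X - Polynomial.C a) ^ m * (X - Polynomial.C b') ^ k * r := by
    rw [hp1, hq]
    simp only [Polynomial.derivative_mul, Polynomial.derivative_X_sub_C_pow, r, X]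
    simp only [Nat.add_sub_cancel, map_natCast, Nat.cast_add, Nat.cast_one]
    ring_nf
    try simp
    try ring
  have hr : r.eval a * r.eval b' < 0 := by
    have h1 : r.eval a = (m + 1) * (a - b') * q.eval a := by simp [r, X]
    have h2 : r.eval b' = (k + 1) * (b' - a) * q.eval b' := by simp [r, X]
    rw [h1, h2]
    have : (m + 1) * (a - b') * q.eval a * ((k + 1) * (b' - a) * q.eval b')
      = - (((m + 1) * (k + 1) * (b' - a) ^ 2) * (q.eval a * q.eval b')) := by ring
    rw [this, neg_lt_zero]
    have := sub_pos.2 hab'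
    positivity
  obtain ⟨c, c1, c2, c3⟩ := h r a b' hab' hr
  exact ⟨c, c1, c2.trans_le hb'b, by rw [hd]; simp [c3]⟩

theorem ivt_mvt {R : Type} [Field R] [LinearOrder R] [IsStrictOrderedRing R] (h : IVTField R)
    (p : Polynomial R) (a b : R) (hab : a < b) :
    ∃ c, a < c ∧ c < b ∧ p.eval b - p.eval a = p.derivative.eval c * (b - a) := by
  have hba := (sub_pos.2 hab).ne'
  let s := (p.eval b - p.eval a) / (b - a)
  let g : Polynomial R := p - Polynomial.C (p.eval a) - Polynomial.C s * (Polynomial.X - Polynomial.C a)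
  obtain ⟨c, c1, c2, c3⟩ := ivt_rolle h g a b hab (by simp [g]) (by simp [g, s]; field_simp; ring)
  refine ⟨c, c1, c2, ?_⟩
  simp [g] at c3
  have : p.derivative.eval c = s := by linarith
  rw [this]; simp only [s]; field_simp

/-- no root on an open interval: constant sign there -/
theorem ivt_sign {R : Type} [Field R] [LinearOrder R] [IsStrictOrderedRing R] (h : IVTField R)
    (p : Polynomial R) (a b x y : R) (hno : ∀ c, a < c → c < b → p.eval c ≠ 0)
    (hx1 : a < x) (hx2 : x < b) (hy1 : a < y) (hy2 : y < b) :
    SignType.sign (p.eval x) = SignType.sign (p.eval y) := by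
  wlog hxy : x ≤ y generalizing x y
  · exact (this y x hy1 hy2 hx1 hx2 (le_of_not_ge hxy)).symm
  rcases hxy.eq_or_lt with rfl | hlt
  · rfl
  have hx := hno x hx1 hx2
  have hy := hno y hy1 hy2
  by_cases hneg : p.eval x * p.eval y < 0
  · obtain ⟨c, c1, c2, c3⟩ := h p x y hlt hneg
    exact absurd c3 (hno c (hx1.trans c1) (c2.trans hy2))
  · have : 0 < p.eval x * p.eval y := lt_of_le_of_ne (not_lt.1 hneg) (mul_ne_zero hx hy).symm
    rcases mul_pos_iff.1 this with ⟨h1, h2⟩ | ⟨h1, h2⟩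
    · rw [sign_pos h1, sign_pos h2]
    · rw [sign_neg h1, sign_neg h2]

/-- derivative without root on the interval and a root inside: signs change at end points -/
theorem ivt_cross {R : Type} [Field R] [LinearOrder R] [IsStrictOrderedRing R] (h : IVTField R)
    (p : Polynomial R) (a b x : R) (hno : ∀ c, a < c → c < b → p.derivative.eval c ≠ 0)
    (hx1 : a < x) (hx2 : x < b) (hx : p.eval x = 0) :
    p.eval a * p.eval b < 0 := by
  obtain ⟨c, c1, c2, c3⟩ := ivt_mvt h p a x hx1
  obtain ⟨e, e1, e2, e3⟩ := ivt_mvt h p x b hx2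
  have hs := ivt_sign h p.derivative a b c e hno c1 (c2.trans hx2) (hx1.trans e1) e2
  have hc := hno c c1 (c2.trans hx2)
  rw [hx] at c3 e3
  have ha : p.eval a = - (p.derivative.eval c * (x - a)) := by linarith
  have hb : p.eval b = p.derivative.eval e * (b - x) := by linarith
  have h1 := sub_pos.2 hx1
  have h2 := sub_pos.2 hx2
  have hce : 0 < p.derivative.eval c * p.derivative.eval e := by
    rcases lt_or_gt_of_ne hc with h3 | h3
    · rw [sign_neg h3] at hs
      exact mul_pos_of_neg_of_neg h3 (sign_eq_neg_one_iff.1 hs.symm)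
    · rw [sign_pos h3] at hs
      exact mul_pos h3 (sign_eq_one_iff.1 hs.symm)
  rw [ha, hb]
  have : -(p.derivative.eval c * (x - a)) * (p.derivative.eval e * (b - x))
    = - ((p.derivative.eval c * p.derivative.eval e) * ((x - a) * (b - x))) := by ring
  rw [this, neg_lt_zero]
  positivity


theorem monic_root_bound {R : Type} [Field R] [LinearOrder R] [IsStrictOrderedRing R]
    (p : Polynomial R) (hp : p.Monic) (x : R) (hx : p.eval x = 0) :
    |x| < 1 + ∑ i ∈ Finset.range p.natDegree, (1 + p.coeff i ^ 2) := by
  have hS : 0 ≤ ∑ i ∈ Finset.range p.natDegree, (1 + p.coeff i ^ 2) :=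
    Finset.sum_nonneg fun i _ => by positivity
  by_contra hlt
  rw [not_lt] at hlt
  have hx1 : 1 ≤ |x| := by linarith
  have hn : p.natDegree ≠ 0 := by
    intro h0
    rw [Polynomial.eq_one_of_monic_natDegree_zero hp h0] at hx
    simp at hx
  obtain ⟨n, hn'⟩ := Nat.exists_eq_succ_of_ne_zero hn
  have h1 : x ^ p.natDegree = - ∑ i ∈ Finset.range p.natDegree, p.coeff i * x ^ i := by
    have := hx
    rw [hp.as_sum] at this
    simp [Polynomial.eval_finsetSum] at this
    linarith
  have h2 : |x| ^ p.natDegree ≤ (∑ i ∈ Finset.range p.natDegree, (1 + p.coeff i ^ 2)) * |x| ^ n := by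
    rw [← abs_pow, h1, abs_neg, Finset.sum_mul]
    refine (Finset.abs_sum_le_sum_abs _ _).trans (Finset.sum_le_sum fun i hi => ?_)
    rw [abs_mul, abs_pow]
    have hi' : i ≤ n := by have := Finset.mem_range.1 hi; omega
    have h3 : |p.coeff i| ≤ 1 + p.coeff i ^ 2 := by
      rw [← sq_abs]; nlinarith [sq_nonneg (|p.coeff i| - 1), abs_nonneg (p.coeff i)]
    exact mul_le_mul h3 (pow_le_pow_right₀ hx1 hi') (by positivity) (by positivity)
  have hpos : 0 < |x| ^ n := by positivity
  rw [hn', pow_succ'] at h2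
  rw [hn'] at hlt
  have := le_of_mul_le_mul_right h2 hpos
  linarith

theorem select_interval {G R : Type} [CommRing G] [Field R] [LinearOrder R]
    (f : G →+* R) (F : Finset (Polynomial R)) (hF0 : ∀ g ∈ F, g ≠ 0)
    (hF : ∀ g ∈ F, ∀ c, g.eval c = 0 → c ∈ Set.range f) (x : R) (hx : x ∉ Set.range f)
    (A B : G) (hA : f A < x) (hB : x < f B) :
    ∃ u v : G, f u < x ∧ x < f v ∧ ∀ g ∈ F, ∀ c, f u < c → c < f v → g.eval c ≠ 0 := by
  classical
  let Z : Finset R := F.biUnion fun g => g.roots.toFinset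
  have hZ : ∀ c ∈ Z, c ∈ Set.range f := by
    intro c hc
    simp only [Z, Finset.mem_biUnion, Multiset.mem_toFinset] at hc
    obtain ⟨g, hg, hc⟩ := hc
    exact hF g hg c (by simpa using (Polynomial.mem_roots'.1 hc).2)
  let Lo := insert (f A) (Z.filter (· < x))
  let Hi := insert (f B) (Z.filter (x < ·))
  have hLo : Lo.Nonempty := Finset.insert_nonempty _ _
  have hHi : Hi.Nonempty := Finset.insert_nonempty _ _
  have hLm := Lo.max'_mem hLo
  have hHm := Hi.min'_mem hHi
  have h1 : Lo.max' hLo ∈ Set.range f ∧ Lo.max' hLo < x := by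
    rcases Finset.mem_insert.1 hLm with h | h
    · rw [h]; exact ⟨⟨A, rfl⟩, hA⟩
    · exact ⟨hZ _ (Finset.mem_filter.1 h).1, (Finset.mem_filter.1 h).2⟩
  have h2 : Hi.min' hHi ∈ Set.range f ∧ x < Hi.min' hHi := by
    rcases Finset.mem_insert.1 hHm with h | h
    · rw [h]; exact ⟨⟨B, rfl⟩, hB⟩
    · exact ⟨hZ _ (Finset.mem_filter.1 h).1, (Finset.mem_filter.1 h).2⟩
  obtain ⟨⟨u, hu⟩, hu'⟩ := h1
  obtain ⟨⟨v, hv⟩, hv'⟩ := h2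
  refine ⟨u, v, hu ▸ hu', hv ▸ hv', ?_⟩
  intro g hg c hc1 hc2 hc0
  have hcZ : c ∈ Z := by
    simp only [Z, Finset.mem_biUnion, Multiset.mem_toFinset]
    exact ⟨g, hg, by simp [hF0 g hg, hc0]⟩
  rcases lt_trichotomy c x with h | h | h
  · have : c ≤ Lo.max' hLo := Lo.le_max' c (Finset.mem_insert_of_mem (Finset.mem_filter.2 ⟨hcZ, h⟩))
    rw [← hu] at this; exact absurd hc1 (not_lt.2 this)
  · exact hx (h ▸ hZ c hcZ)
  · have : Hi.min' hHi ≤ c := Hi.min'_le c (Finset.mem_insert_of_mem (Finset.mem_filter.2 ⟨hcZ, h⟩))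
    rw [← hv] at this; exact absurd hc2 (not_lt.2 this)

section key
variable {G R1 R2 : Type} [CommRing G] [Field R1] [LinearOrder R1] [IsStrictOrderedRing R1]
  [Field R2] [LinearOrder R2] [IsStrictOrderedRing R2]

theorem sign_lt_iff (f1 : G →+* R1) (f2 : G →+* R2)
    (hs : ∀ g, SignType.sign (f1 g) = SignType.sign (f2 g)) (a b : G) :
    f1 a < f1 b ↔ f2 a < f2 b := by
  have := hs (b - a)
  rw [map_sub f1, map_sub f2] at this
  rw [← sub_pos, ← sub_pos (a := f2 b), ← sign_eq_one_iff, ← sign_eq_one_iff, this]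

theorem sign_zero_iff (f1 : G →+* R1) (f2 : G →+* R2)
    (hs : ∀ g, SignType.sign (f1 g) = SignType.sign (f2 g)) (a : G) :
    f1 a = 0 ↔ f2 a = 0 := by
  rw [← sign_eq_zero_iff, ← sign_eq_zero_iff (a := f2 a), hs]

theorem eval_map_apply (f1 : G →+* R1) (g : Polynomial G) (m : G) :
    (g.map f1).eval (f1 m) = f1 (g.eval m) := by
  rw [Polynomial.eval_map, Polynomial.eval₂_at_apply]

theorem key_finite (f1 : G →+* R1) (f2 : G →+* R2) (I1 : IVTField R1) (I2 : IVTField R2)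
    (hs : ∀ g, SignType.sign (f1 g) = SignType.sign (f2 g))
    (hu : ∀ g, f1 g ≠ 0 → IsUnit g) (hi : Function.Injective f1) (n : ℕ)
    (h1 : ∀ g : Polynomial G, g ≠ 0 → g.natDegree < n → ∀ x, (g.map f1).eval x = 0 → x ∈ Set.range f1)
    (h2 : ∀ g : Polynomial G, g ≠ 0 → g.natDegree < n → ∀ x, (g.map f2).eval x = 0 → x ∈ Set.range f2)
    (p : Polynomial G) (hp : p.Monic) (hpn : p.natDegree = n) (θ : R1)
    (hθ : (p.map f1).eval θ = 0) (hθr : θ ∉ Set.range f1)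
    (F : Finset (Polynomial G)) (hF : ∀ g ∈ F, g.natDegree < n) :
    ∃ θ' : R2, (p.map f2).eval θ' = 0 ∧
      ∀ g ∈ F, SignType.sign ((g.map f1).eval θ) = SignType.sign ((g.map f2).eval θ') := by
  classical
  have hnt : Nontrivial G := f1.domain_nontrivial
  have hi2 : Function.Injective f2 := by
    rw [injective_iff_map_eq_zero] at hi ⊢
    intro a ha; exact hi a ((sign_zero_iff f1 f2 hs a).2 ha)
  have hn : n ≠ 0 := by
    rintro rfl
    rw [Polynomial.eq_one_of_monic_natDegree_zero hp hpn] at hθ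
    simp at hθ
  have hd0 : p.derivative ≠ 0 := by
    intro h0
    have : (p.map f1).derivative = 0 := by rw [Polynomial.derivative_map, h0, Polynomial.map_zero]
    have := Polynomial.derivative_eq_zero.1 this
    rw [hp.natDegree_map, hpn] at this
    exact hn this
  have hdn : p.derivative.natDegree < n := hpn ▸ Polynomial.natDegree_derivative_lt (hpn ▸ hn)
  let F' := insert p.derivative (F.filter (· ≠ 0))
  have hF'0 : ∀ g ∈ F', g ≠ 0 := by
    intro g hg
    rcases Finset.mem_insert.1 hg with h | h
    · rw [h]; exact hd0
    · exact (Finset.mem_filter.1 h).2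
  have hF'n : ∀ g ∈ F', g.natDegree < n := by
    intro g hg
    rcases Finset.mem_insert.1 hg with h | h
    · rw [h]; exact hdn
    · exact hF g (Finset.mem_filter.1 h).1
  have hb := monic_root_bound (p.map f1) (hp.map f1) θ hθ
  let B : G := 1 + ∑ i ∈ Finset.range p.natDegree, (1 + p.coeff i ^ 2)
  have hB : f1 B = 1 + ∑ i ∈ Finset.range (p.map f1).natDegree, (1 + (p.map f1).coeff i ^ 2) := by
    rw [hp.natDegree_map]
    simp [B]
  rw [← hB, abs_lt] at hb
  obtain ⟨u, v, hu1, hv1, huv⟩ := select_interval f1 (F'.image (fun g => g.map f1))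
    (by
      intro g hg
      obtain ⟨g, hg', rfl⟩ := Finset.mem_image.1 hg
      exact (Polynomial.map_ne_zero_iff hi).2 (hF'0 g hg'))
    (by
      intro g hg c hc
      obtain ⟨g, hg', rfl⟩ := Finset.mem_image.1 hg
      exact h1 g (hF'0 g hg') (hF'n g hg') c hc)
    θ hθr (-B) B (by simpa using hb.1) hb.2
  have hno1 : ∀ g ∈ F', ∀ c, f1 u < c → c < f1 v → (g.map f1).eval c ≠ 0 := fun g hg =>
    huv _ (Finset.mem_image_of_mem _ hg)
  have hno2 : ∀ g ∈ F', ∀ c, f2 u < c → c < f2 v → (g.map f2).eval c ≠ 0 := by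
    intro g hg c hc1 hc2 hc0
    obtain ⟨w, rfl⟩ := h2 g (hF'0 g hg) (hF'n g hg) c hc0
    rw [eval_map_apply, ← sign_zero_iff f1 f2 hs, ← eval_map_apply] at hc0
    exact hno1 g hg (f1 w) ((sign_lt_iff f1 f2 hs _ _).2 hc1) ((sign_lt_iff f1 f2 hs _ _).2 hc2) hc0
  have hcross := ivt_cross I1 (p.map f1) (f1 u) (f1 v) θ
    (by
      intro c hc1 hc2
      rw [Polynomial.derivative_map]
      exact hno1 _ (Finset.mem_insert_self _ _) c hc1 hc2) hu1 hv1 hθ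
  have huv1 : f1 u < f1 v := hu1.trans hv1
  have huv2 : f2 u < f2 v := (sign_lt_iff f1 f2 hs _ _).1 huv1
  have hcross2 : (p.map f2).eval (f2 u) * (p.map f2).eval (f2 v) < 0 := by
    rw [eval_map_apply, eval_map_apply, ← map_mul] at hcross ⊢
    rw [← sign_eq_neg_one_iff] at hcross ⊢
    rw [← hs]; exact hcross
  obtain ⟨θ', ht1, ht2, ht0⟩ := I2 (p.map f2) _ _ huv2 hcross2
  refine ⟨θ', ht0, ?_⟩
  intro g hg
  by_cases hg0 : g = 0
  · simp [hg0]
  have hgF : g ∈ F' := Finset.mem_insert_of_mem (Finset.mem_filter.2 ⟨hg, hg0⟩)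
  -- midpoint
  obtain ⟨t, ht⟩ := hu 2 (by rw [map_ofNat]; simp)
  have htt : (2 : G) * ((t⁻¹ : Gˣ) : G) = 1 := by rw [← ht]; simp
  let m : G := (u + v) * ((t⁻¹ : Gˣ) : G)
  have hm : 2 * m = u + v := by
    simp only [m]; linear_combination (u + v) * htt
  have hm1 : 2 * f1 m = f1 u + f1 v := by
    have := congrArg f1 hm; simpa [map_ofNat] using this
  have hm2 : 2 * f2 m = f2 u + f2 v := by
    have := congrArg f2 hm; simpa [map_ofNat] using this
  rw [ivt_sign I1 (g.map f1) (f1 u) (f1 v) θ (f1 m) (hno1 g hgF) hu1 hv1 (by linarith) (by linarith),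
    ivt_sign I2 (g.map f2) (f2 u) (f2 v) θ' (f2 m) (hno2 g hgF) ht1 ht2 (by linarith) (by linarith),
    eval_map_apply, eval_map_apply, hs]

theorem key_all (f1 : G →+* R1) (f2 : G →+* R2) (I1 : IVTField R1) (I2 : IVTField R2)
    (hs : ∀ g, SignType.sign (f1 g) = SignType.sign (f2 g))
    (hu : ∀ g, f1 g ≠ 0 → IsUnit g) (hi : Function.Injective f1) (n : ℕ)
    (h1 : ∀ g : Polynomial G, g ≠ 0 → g.natDegree < n → ∀ x, (g.map f1).eval x = 0 → x ∈ Set.range f1)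
    (h2 : ∀ g : Polynomial G, g ≠ 0 → g.natDegree < n → ∀ x, (g.map f2).eval x = 0 → x ∈ Set.range f2)
    (p : Polynomial G) (hp : p.Monic) (hpn : p.natDegree = n) (θ : R1)
    (hθ : (p.map f1).eval θ = 0) (hθr : θ ∉ Set.range f1) :
    ∃ θ' : R2, ∀ g : Polynomial G,
      SignType.sign ((g.map f1).eval θ) = SignType.sign ((g.map f2).eval θ') := by
  classical
  have hnt : Nontrivial G := f1.domain_nontrivial
  have hp1 : p ≠ 1 := by rintro rfl; simp at hθ
  have hstep : ∃ θ' : R2, (p.map f2).eval θ' = 0 ∧ ∀ g : Polynomial G, g.natDegree < n →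
      SignType.sign ((g.map f1).eval θ) = SignType.sign ((g.map f2).eval θ') := by
    by_contra hcon
    push Not at hcon
    choose! w hw1 hw2 using hcon
    obtain ⟨θ', ht, hg⟩ := key_finite f1 f2 I1 I2 hs hu hi n h1 h2 p hp hpn θ hθ hθr
      ((p.map f2).roots.toFinset.image w) (by
        intro g hg
        obtain ⟨c, hc, rfl⟩ := Finset.mem_image.1 hg
        exact hw1 c (Polynomial.mem_roots'.1 (Multiset.mem_toFinset.1 hc)).2)
    refine hw2 θ' ht (hg _ (Finset.mem_image_of_mem _ ?_))
    rw [Multiset.mem_toFinset, Polynomial.mem_roots']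
    exact ⟨(hp.map f2).ne_zero, ht⟩
  obtain ⟨θ', ht, hg⟩ := hstep
  refine ⟨θ', fun g => ?_⟩
  have hmod := Polynomial.modByMonic_add_div g p
  have e1 : (g.map f1).eval θ = ((g %ₘ p).map f1).eval θ := by
    conv_lhs => rw [← hmod]
    simp [hθ]
  have e2 : (g.map f2).eval θ' = ((g %ₘ p).map f2).eval θ' := by
    conv_lhs => rw [← hmod]
    simp [ht]
  rw [e1, e2]
  exact hg _ (hpn ▸ Polynomial.natDegree_modByMonic_lt g hp hp1)

end key


section transfer
variable {R1 R2 : Type} [Field R1] [LinearOrder R1] [IsStrictOrderedRing R1]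
  [Field R2] [LinearOrder R2] [IsStrictOrderedRing R2]

/-- partial order isomorphisms, as graphs -/
def Matched (Γ : Subring (R1 × R2)) : Prop :=
  ∀ z ∈ Γ, SignType.sign z.1 = SignType.sign z.2

theorem exists_max_matched (Γ0 : Subring (R1 × R2)) (h0 : Matched Γ0) :
    ∃ Γ, Γ0 ≤ Γ ∧ Matched Γ ∧ ∀ Γ', Matched Γ' → Γ ≤ Γ' → Γ' ≤ Γ := by
  obtain ⟨m, hm, hmax⟩ := zorn_le_nonempty₀ {Γ : Subring (R1 × R2) | Matched Γ} (by
    intro c hc hch y hy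
    refine ⟨sSup c, ?_, fun z hz => le_sSup hz⟩
    intro z hz
    obtain ⟨s, hs, hzs⟩ := (Subring.mem_sSup_of_directedOn ⟨y, hy⟩ hch.directedOn).1 hz
    exact hc hs z hzs) Γ0 h0
  exact ⟨m, hm, hmax.prop, fun Γ' h1 h2 => hmax.le_of_ge h1 h2⟩

def fracRing (Γ : Subring (R1 × R2)) (hΓ : Matched Γ) : Subring (R1 × R2) where
  carrier := {w | ∃ c ∈ Γ, c.1 ≠ 0 ∧ c * w ∈ Γ}
  mul_mem' := by
    rintro a b ⟨c, hc, hc1, hca⟩ ⟨e, he, he1, heb⟩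
    refine ⟨c * e, Γ.mul_mem hc he, mul_ne_zero hc1 he1, ?_⟩
    have : c * e * (a * b) = (c * a) * (e * b) := by ring
    rw [this]; exact Γ.mul_mem hca heb
  one_mem' := ⟨1, Γ.one_mem, one_ne_zero, by simpa using Γ.one_mem⟩
  add_mem' := by
    rintro a b ⟨c, hc, hc1, hca⟩ ⟨e, he, he1, heb⟩
    refine ⟨c * e, Γ.mul_mem hc he, mul_ne_zero hc1 he1, ?_⟩
    have : c * e * (a + b) = e * (c * a) + c * (e * b) := by ring
    rw [this]; exact Γ.add_mem (Γ.mul_mem he hca) (Γ.mul_mem hc heb)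
  zero_mem' := ⟨1, Γ.one_mem, one_ne_zero, by simpa using Γ.zero_mem⟩
  neg_mem' := by
    rintro a ⟨c, hc, hc1, hca⟩
    exact ⟨c, hc, hc1, by simpa using Γ.neg_mem hca⟩

theorem signType_cancel (a b c : SignType) (h : a ≠ 0) (h2 : a * b = a * c) : b = c := by
  revert a b c; decide

theorem fracRing_matched (Γ : Subring (R1 × R2)) (hΓ : Matched Γ) : Matched (fracRing Γ hΓ) := by
  rintro w ⟨c, hc, hc1, hcw⟩
  have h1 := hΓ _ hcw
  rw [Prod.fst_mul, Prod.snd_mul, sign_mul, sign_mul, ← hΓ c hc] at h1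
  exact signType_cancel _ _ _ (by rwa [Ne, sign_eq_zero_iff]) h1

theorem le_fracRing (Γ : Subring (R1 × R2)) (hΓ : Matched Γ) : Γ ≤ fracRing Γ hΓ :=
  fun w hw => ⟨1, Γ.one_mem, one_ne_zero, by simpa using hw⟩

theorem transfer_one {A : Type} [CommRing A] (φ : A →+* R1) (ψ : A →+* R2)
    (I1 : IVTField R1) (I2 : IVTField R2)
    (hs : ∀ a, SignType.sign (φ a) = SignType.sign (ψ a)) (F : Finset (Polynomial A)) (x : R1) :
    ∃ x' : R2, ∀ p ∈ F, SignType.sign (p.eval₂ φ x) = SignType.sign (p.eval₂ ψ x') := by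
  classical
  obtain ⟨Γ, hΓ0, hΓ, hmax⟩ := exists_max_matched (φ.prod ψ).range (by
    rintro z ⟨a, rfl⟩
    exact hs a)
  let f1 : Γ →+* R1 := (RingHom.fst R1 R2).comp Γ.subtype
  let f2 : Γ →+* R2 := (RingHom.snd R1 R2).comp Γ.subtype
  have hs' : ∀ g, SignType.sign (f1 g) = SignType.sign (f2 g) := fun g => hΓ g g.2
  have hz : ∀ g, f1 g = 0 ↔ f2 g = 0 := sign_zero_iff f1 f2 hs'
  have hi : Function.Injective f1 := by
    rw [injective_iff_map_eq_zero]
    intro a ha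
    exact Subtype.ext (Prod.ext ha ((hz a).1 ha))
  have hi2 : Function.Injective f2 := by
    rw [injective_iff_map_eq_zero]
    intro a ha
    exact Subtype.ext (Prod.ext ((hz a).2 ha) ha)
  have hu : ∀ g, f1 g ≠ 0 → IsUnit g := by
    intro g hg
    have hg2 : f2 g ≠ 0 := fun h => hg ((hz g).2 h)
    have : ((f1 g)⁻¹, (f2 g)⁻¹) ∈ Γ := hmax _ (fracRing_matched Γ hΓ) (le_fracRing Γ hΓ)
      ⟨g, g.2, hg, by
        have : (g : R1 × R2) * ((f1 g)⁻¹, (f2 g)⁻¹) = 1 :=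
          Prod.ext (mul_inv_cancel₀ hg) (mul_inv_cancel₀ hg2)
        rw [this]; exact Γ.one_mem⟩
    refine IsUnit.of_mul_eq_one ⟨_, this⟩ (Subtype.ext ?_)
    exact Prod.ext (mul_inv_cancel₀ hg) (mul_inv_cancel₀ hg2)
  have hu2 : ∀ g, f2 g ≠ 0 → IsUnit g := fun g hg => hu g (fun h => hg ((hz g).1 h))
  have hext : ∀ (t : R1) (t' : R2), (∀ g : Polynomial Γ,
      SignType.sign ((g.map f1).eval t) = SignType.sign ((g.map f2).eval t')) → (t, t') ∈ Γ := by
    intro t t' h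
    let E := Polynomial.eval₂RingHom Γ.subtype (t, t')
    have hE : Matched E.range := by
      rintro z ⟨g, rfl⟩
      have e1 : (E g).1 = (g.map f1).eval t := by
        rw [Polynomial.eval_map]
        exact Polynomial.hom_eval₂ g Γ.subtype (RingHom.fst R1 R2) (t, t')
      have e2 : (E g).2 = (g.map f2).eval t' := by
        rw [Polynomial.eval_map]
        exact Polynomial.hom_eval₂ g Γ.subtype (RingHom.snd R1 R2) (t, t')
      rw [e1, e2]; exact h g
    refine hmax _ hE (fun z hz => ⟨Polynomial.C ⟨z, hz⟩, by simp [E]⟩) ⟨Polynomial.X, by simp [E]⟩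
  have hnorm : ∀ g : Polynomial Γ, g ≠ 0 → ∃ q : Polynomial Γ, q.Monic ∧ q.natDegree = g.natDegree ∧
      ∃ c : Γ, q = Polynomial.C c * g := by
    intro g hg
    have hl : IsUnit g.leadingCoeff := by
      apply hu
      rw [Ne, map_eq_zero_iff f1 hi, Polynomial.leadingCoeff_eq_zero]; exact hg
    obtain ⟨t, ht⟩ := hl
    refine ⟨Polynomial.C ((t⁻¹ : Γˣ) : Γ) * g, ?_, ?_, _, rfl⟩
    · apply Polynomial.monic_C_mul_of_mul_leadingCoeff_eq_one
      rw [← ht]; simp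
    · exact Polynomial.natDegree_C_mul_of_mul_ne_zero (by rw [← ht]; simp)
  have hclosed : ∀ n, ∀ p : Polynomial Γ, p ≠ 0 → p.natDegree = n →
      (∀ t, (p.map f1).eval t = 0 → t ∈ Set.range f1) ∧
      (∀ t, (p.map f2).eval t = 0 → t ∈ Set.range f2) := by
    intro n
    induction n using Nat.strong_induction_on with
    | _ n ih =>
      intro p hp hpn
      have h1 : ∀ g : Polynomial Γ, g ≠ 0 → g.natDegree < n → ∀ x, (g.map f1).eval x = 0 →
        x ∈ Set.range f1 := fun g hg hgn => (ih _ hgn g hg rfl).1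
      have h2 : ∀ g : Polynomial Γ, g ≠ 0 → g.natDegree < n → ∀ x, (g.map f2).eval x = 0 →
        x ∈ Set.range f2 := fun g hg hgn => (ih _ hgn g hg rfl).2
      obtain ⟨q, hq, hqn, c, hqc⟩ := hnorm p hp
      constructor
      · intro t ht
        by_contra hcon
        obtain ⟨t', h⟩ := key_all f1 f2 I1 I2 hs' hu hi n h1 h2 q hq (hqn.trans hpn) t
          (by rw [hqc]; simp [ht]) hcon
        exact hcon ⟨⟨_, hext t t' h⟩, rfl⟩
      · intro t ht
        by_contra hcon
        obtain ⟨t', h⟩ := key_all f2 f1 I2 I1 (fun g => (hs' g).symm) hu2 hi2 n h2 h1 q hq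
          (hqn.trans hpn) t (by rw [hqc]; simp [ht]) hcon
        exact hcon ⟨⟨_, hext t' t (fun g => (h g).symm)⟩, rfl⟩
  -- pass to Γ
  let ι : A →+* Γ := (φ.prod ψ).codRestrict Γ (fun a => hΓ0 ⟨a, rfl⟩)
  have e1 : ∀ (p : Polynomial A) (t : R1), p.eval₂ φ t = ((p.map ι).map f1).eval t := by
    intro p t
    rw [Polynomial.map_map, Polynomial.eval_map]; rfl
  have e2 : ∀ (p : Polynomial A) (t : R2), p.eval₂ ψ t = ((p.map ι).map f2).eval t := by
    intro p t
    rw [Polynomial.map_map, Polynomial.eval_map]; rfl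
  suffices hm : ∃ m : Γ, ∀ p ∈ F, SignType.sign (((p.map ι).map f1).eval x) =
      SignType.sign (((p.map ι).map f1).eval (f1 m)) by
    obtain ⟨m, hm⟩ := hm
    refine ⟨f2 m, fun p hp => ?_⟩
    rw [e1, e2, hm p hp, eval_map_apply, eval_map_apply, hs']
  by_cases hx : x ∈ Set.range f1
  · obtain ⟨m, rfl⟩ := hx
    exact ⟨m, fun _ _ => rfl⟩
  let Z : Finset R1 := (F.biUnion fun p => ((p.map ι).map f1).roots.toFinset)
  have hZ : ∀ c ∈ Z, c ∈ Set.range f1 := by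
    intro c hc
    simp only [Z, Finset.mem_biUnion, Multiset.mem_toFinset] at hc
    obtain ⟨g, hg, hc⟩ := hc
    have := Polynomial.mem_roots'.1 hc
    exact (hclosed _ (g.map ι) (fun h0 => this.1 (by rw [h0]; simp)) rfl).1 c this.2
  -- choose m
  have hmid : ∃ m : Γ, ∀ c ∈ Z, (c < x → c < f1 m) ∧ (x < c → f1 m < c) := by
    let Lo := Z.filter (· < x)
    let Hi := Z.filter (x < ·)
    by_cases hLo : Lo.Nonempty
    · have hLm := Finset.mem_filter.1 (Lo.max'_mem hLo)
      obtain ⟨u, hu'⟩ := hZ _ hLm.1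
      by_cases hHi : Hi.Nonempty
      · have hHm := Finset.mem_filter.1 (Hi.min'_mem hHi)
        obtain ⟨v, hv'⟩ := hZ _ hHm.1
        obtain ⟨t, ht⟩ := hu 2 (by rw [map_ofNat]; simp)
        have htt : (2 : Γ) * ((t⁻¹ : Γˣ) : Γ) = 1 := by rw [← ht]; simp
        let m : Γ := (u + v) * ((t⁻¹ : Γˣ) : Γ)
        have hm : 2 * m = u + v := by
          simp only [m]; linear_combination (u + v) * htt
        have hm1 : 2 * f1 m = f1 u + f1 v := by
          have := congrArg f1 hm; rw [map_mul, map_ofNat, map_add] at this; exact this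
        have huv : f1 u < f1 v := by rw [hu', hv']; exact hLm.2.trans hHm.2
        refine ⟨m, fun c hc => ⟨fun h => ?_, fun h => ?_⟩⟩
        · have := Lo.le_max' c (Finset.mem_filter.2 ⟨hc, h⟩)
          linarith
        · have := Hi.min'_le c (Finset.mem_filter.2 ⟨hc, h⟩)
          linarith
      · refine ⟨u + 1, fun c hc => ⟨fun h => ?_, fun h => ?_⟩⟩
        · have := Lo.le_max' c (Finset.mem_filter.2 ⟨hc, h⟩)
          rw [map_add, map_one]; linarith
        · exact absurd ⟨c, Finset.mem_filter.2 ⟨hc, h⟩⟩ hHi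
    · by_cases hHi : Hi.Nonempty
      · have hHm := Finset.mem_filter.1 (Hi.min'_mem hHi)
        obtain ⟨v, hv'⟩ := hZ _ hHm.1
        refine ⟨v - 1, fun c hc => ⟨fun h => ?_, fun h => ?_⟩⟩
        · exact absurd ⟨c, Finset.mem_filter.2 ⟨hc, h⟩⟩ hLo
        · have := Hi.min'_le c (Finset.mem_filter.2 ⟨hc, h⟩)
          rw [map_sub, map_one]; linarith
      · refine ⟨0, fun c hc => ⟨fun h => ?_, fun h => ?_⟩⟩
        · exact absurd ⟨c, Finset.mem_filter.2 ⟨hc, h⟩⟩ hLo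
        · exact absurd ⟨c, Finset.mem_filter.2 ⟨hc, h⟩⟩ hHi
  obtain ⟨m, hm⟩ := hmid
  refine ⟨m, fun p hp => ?_⟩
  set g := (p.map ι).map f1 with hg
  by_cases hg0 : g = 0
  · simp [hg0]
  have hroot : ∀ c, g.eval c = 0 → c ≠ x ∧ (c < x → c < f1 m) ∧ (x < c → f1 m < c) := by
    intro c hc
    have hcZ : c ∈ Z := by
      simp only [Z, Finset.mem_biUnion, Multiset.mem_toFinset]
      exact ⟨p, hp, Polynomial.mem_roots'.2 ⟨hg0, hc⟩⟩
    refine ⟨fun h => hx (h ▸ hZ c hcZ), hm c hcZ⟩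
  have hgx : g.eval x ≠ 0 := fun h => (hroot x h).1 rfl
  have hgm : g.eval (f1 m) ≠ 0 := fun h => by
    obtain ⟨h1, h2, h3⟩ := hroot _ h
    rcases lt_or_gt_of_ne h1 with h4 | h4
    · exact lt_irrefl _ (h2 h4)
    · exact lt_irrefl _ (h3 h4)
  by_cases hneg : g.eval x * g.eval (f1 m) < 0
  · exfalso
    rcases lt_trichotomy x (f1 m) with h | h | h
    · obtain ⟨c, c1, c2, c3⟩ := I1 g x (f1 m) h hneg
      exact absurd ((hroot c c3).2.2 c1) (not_lt.2 c2.le)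
    · exact hx ⟨m, h.symm⟩
    · obtain ⟨c, c1, c2, c3⟩ := I1 g (f1 m) x h (by rwa [mul_comm])
      exact absurd ((hroot c c3).2.1 c2) (not_lt.2 c1.le)
  · have : 0 < g.eval x * g.eval (f1 m) := lt_of_le_of_ne (not_lt.1 hneg) (mul_ne_zero hgx hgm).symm
    rcases mul_pos_iff.1 this with ⟨h1, h2⟩ | ⟨h1, h2⟩
    · rw [sign_pos h1, sign_pos h2]
    · rw [sign_neg h1, sign_neg h2]

end transfer


theorem real_ivt (p : Polynomial ℝ) (a b : ℝ) (hab : a < b) (h : p.eval a * p.eval b < 0) :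
    ∃ c, a < c ∧ c < b ∧ p.eval c = 0 := by
  have hc : ContinuousOn (fun x => p.eval x) (Set.Icc a b) := p.continuous.continuousOn
  rcases mul_neg_iff.1 h with ⟨h1, h2⟩ | ⟨h1, h2⟩
  · obtain ⟨c, hc, h0⟩ := intermediate_value_Ioo' hab.le hc (show (0:ℝ) ∈ _ from ⟨h2, h1⟩)
    exact ⟨c, hc.1, hc.2, h0⟩
  · obtain ⟨c, hc, h0⟩ := intermediate_value_Ioo hab.le hc (show (0:ℝ) ∈ _ from ⟨h1, h2⟩)
    exact ⟨c, hc.1, hc.2, h0⟩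

theorem germ_ivt {ι : Type} (U : Ultrafilter ι) : IVTField (Filter.Germ (U : Filter ι) ℝ) := by
  intro p a b
  induction a using Filter.Germ.inductionOn with | _ a =>
  induction b using Filter.Germ.inductionOn with | _ b =>
  intro hab h
  let co : (ι → ℝ) →+* Filter.Germ (U : Filter ι) ℝ := Filter.Germ.coeRingHom _
  have hco : Function.Surjective co := fun z => Filter.Germ.inductionOn z fun f => ⟨f, rfl⟩
  obtain ⟨q, rfl⟩ := Polynomial.map_surjective co hco p
  have key : ∀ z : ι → ℝ, (q.map co).eval (z : Filter.Germ (U : Filter ι) ℝ) =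
      ((fun i => (q.map (Pi.evalRingHom (fun _ => ℝ) i)).eval (z i) : ι → ℝ) :
        Filter.Germ (U : Filter ι) ℝ) := by
    intro z
    have : (q.map co).eval (co z) = co (q.eval z) := by
      rw [Polynomial.eval_map, Polynomial.eval₂_at_apply]
    refine this.trans ?_
    change ((q.eval z : ι → ℝ) : Filter.Germ (U : Filter ι) ℝ) = _
    congr 1
    funext i
    rw [Polynomial.eval_map]
    exact (Polynomial.eval₂_at_apply (Pi.evalRingHom (fun _ => ℝ) i) z).symm
  rw [key, key, ← Filter.Germ.coe_mul, ← Filter.Germ.coe_zero, Filter.Germ.coe_lt] at h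
  rw [Filter.Germ.coe_lt] at hab
  have hex : ∀ i, ∃ c, (a i < b i ∧ (q.map (Pi.evalRingHom (fun _ => ℝ) i)).eval (a i) *
      (q.map (Pi.evalRingHom (fun _ => ℝ) i)).eval (b i) < 0) → a i < c ∧ c < b i ∧
      (q.map (Pi.evalRingHom (fun _ => ℝ) i)).eval c = 0 := by
    intro i
    by_cases hi : (a i < b i ∧ (q.map (Pi.evalRingHom (fun _ => ℝ) i)).eval (a i) *
      (q.map (Pi.evalRingHom (fun _ => ℝ) i)).eval (b i) < 0)
    · obtain ⟨c, hc⟩ := real_ivt _ _ _ hi.1 hi.2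
      exact ⟨c, fun _ => hc⟩
    · exact ⟨0, fun h => absurd h hi⟩
  choose c hc using hex
  refine ⟨(c : Filter.Germ (U : Filter ι) ℝ), ?_, ?_, ?_⟩
  · rw [Filter.Germ.coe_lt]
    filter_upwards [hab, h] with i h1 h2 using (hc i ⟨h1, h2⟩).1
  · rw [Filter.Germ.coe_lt]
    filter_upwards [hab, h] with i h1 h2 using (hc i ⟨h1, h2⟩).2.1
  · rw [key, ← Filter.Germ.coe_zero, Filter.Germ.coe_eq]
    filter_upwards [hab, h] with i h1 h2 using (hc i ⟨h1, h2⟩).2.2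

theorem germ_sign {ι : Type} (U : Ultrafilter ι) (f : ι → ℝ) (s : SignType) :
    SignType.sign (f : Filter.Germ (U : Filter ι) ℝ) = s ↔
      ∀ᶠ i in (U : Filter ι), SignType.sign (f i) = s := by
  rcases s with _ | _ | _
  · change _ = 0 ↔ ∀ᶠ i in (U : Filter ι), _ = 0
    simp only [sign_eq_zero_iff]
    rw [← Filter.Germ.coe_zero, Filter.Germ.coe_eq]; rfl
  · rw [show SignType.neg = -1 from rfl]
    simp only [sign_eq_neg_one_iff]
    rw [← Filter.Germ.coe_zero, Filter.Germ.coe_lt]; rfl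
  · change _ = 1 ↔ ∀ᶠ i in (U : Filter ι), _ = 1
    simp only [sign_eq_one_iff]
    rw [← Filter.Germ.coe_zero, Filter.Germ.coe_lt]; rfl

theorem sign_hom_real {R : Type} [Field R] [LinearOrder R] [IsStrictOrderedRing R]
    (φ : ℝ →+* R) (c : ℝ) : SignType.sign (φ c) = SignType.sign c := by
  have hpos : ∀ c : ℝ, 0 < c → 0 < φ c := by
    intro c hc
    have h1 : φ c = φ (Real.sqrt c) * φ (Real.sqrt c) := by
      rw [← map_mul, Real.mul_self_sqrt hc.le]
    have h2 : φ c ≠ 0 := (map_ne_zero φ).2 hc.ne'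
    exact lt_of_le_of_ne (by rw [h1]; exact mul_self_nonneg _) h2.symm
  rcases lt_trichotomy c 0 with h | h | h
  · have := hpos (-c) (by linarith)
    rw [map_neg] at this
    rw [sign_neg h, sign_neg (by linarith)]
  · simp [h]
  · rw [sign_pos h, sign_pos (hpos c h)]

/-- Artin–Lang -/
theorem artin_lang {R : Type} [Field R] [LinearOrder R] [IsStrictOrderedRing R] (hR : IVTField R)
    (d : ℕ) : ∀ (φ : MvPolynomial (Fin d) ℝ →+* R) (F : Finset (MvPolynomial (Fin d) ℝ)),
    ∃ y : Fin d → ℝ, ∀ g ∈ F, SignType.sign (eval y g) = SignType.sign (φ g) := by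
  classical
  induction d with
  | zero =>
    intro φ F
    refine ⟨Fin.elim0, fun g _ => ?_⟩
    rw [eq_C_of_isEmpty g, eval_C]
    exact (sign_hom_real (φ.comp C) _).symm
  | succ d ih =>
    intro φ F
    let e := finSuccEquiv ℝ d
    let φ' : MvPolynomial (Fin d) ℝ →+* R :=
      φ.comp ((e.symm : Polynomial (MvPolynomial (Fin d) ℝ) →+* MvPolynomial (Fin (d+1)) ℝ).comp
        Polynomial.C)
    let x : R := φ (e.symm Polynomial.X)
    have hφ : ∀ g, φ g = (e g).eval₂ φ' x := by
      intro g
      have : g = e.symm (e g) := by simp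
      conv_lhs => rw [this]
      induction e g using Polynomial.induction_on' with
      | add p q hp hq => rw [map_add, map_add, hp, hq, Polynomial.eval₂_add]
      | monomial n a =>
        rw [← Polynomial.C_mul_X_pow_eq_monomial]
        simp [φ', x]
    choose y hy using ih φ'
    let ι := Finset (MvPolynomial (Fin d) ℝ)
    let U : Ultrafilter ι := Ultrafilter.of Filter.atTop
    have hU : (U : Filter ι) ≤ Filter.atTop := Ultrafilter.of_le _
    let ψ0 : MvPolynomial (Fin d) ℝ →+* (ι → ℝ) := RingHom.pi (fun i => (eval (y i)))
    let ψ : MvPolynomial (Fin d) ℝ →+* Filter.Germ (U : Filter ι) ℝ :=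
      (Filter.Germ.coeRingHom _).comp ψ0
    have hsgn : ∀ g, SignType.sign (φ' g) = SignType.sign (ψ g) := by
      intro g
      symm
      change SignType.sign ((ψ0 g : ι → ℝ) : Filter.Germ (U : Filter ι) ℝ) = _
      rw [germ_sign]
      refine hU ?_
      filter_upwards [Filter.eventually_ge_atTop {g}] with i hi
      exact hy i g (hi (Finset.mem_singleton_self g))
    obtain ⟨x', hx'⟩ := transfer_one φ' ψ hR (germ_ivt U) hsgn (F.image e) x
    induction x' using Filter.Germ.inductionOn with | _ z =>
    have hev : ∀ g ∈ F, ∀ᶠ i in (U : Filter ι),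
        SignType.sign (eval (Fin.cons (z i) (y i) : Fin (d+1) → ℝ) g) = SignType.sign (φ g) := by
      intro g hg
      have h1 := (hx' (e g) (Finset.mem_image_of_mem _ hg)).symm
      rw [← hφ] at h1
      have h2 : (e g).eval₂ ψ (z : Filter.Germ (U : Filter ι) ℝ) =
          (((e g).eval₂ ψ0 z : ι → ℝ) : Filter.Germ (U : Filter ι) ℝ) :=
        (Polynomial.hom_eval₂ (e g) ψ0 (Filter.Germ.coeRingHom (U : Filter ι)) z).symm
      rw [h2, germ_sign] at h1
      filter_upwards [h1] with i hi
      rw [← hi, eval_eq_eval_mv_eval', Polynomial.eval_map]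
      congr 1
      exact (Polynomial.hom_eval₂ (e g) ψ0 (Pi.evalRingHom (fun _ => ℝ) i) z).symm
    have hall := (Filter.eventually_all_finset F).2 hev
    obtain ⟨i, hi⟩ := hall.exists
    exact ⟨_, hi⟩


structure IsCone {A : Type} [CommRing A] (P : Set A) : Prop where
  add : ∀ x ∈ P, ∀ y ∈ P, x + y ∈ P
  mul : ∀ x ∈ P, ∀ y ∈ P, x * y ∈ P
  sq : ∀ x, x * x ∈ P
  neg : -1 ∉ P

theorem IsCone.zero {A : Type} [CommRing A] {P : Set A} (h : IsCone P) : 0 ∈ P := by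
  simpa using h.sq 0

theorem IsCone.one {A : Type} [CommRing A] {P : Set A} (h : IsCone P) : 1 ∈ P := by
  simpa using h.sq 1

theorem IsCone.adjoin {A : Type} [CommRing A] {P : Set A} (h : IsCone P) (x : A)
    (hx : ∀ s ∈ P, ∀ t ∈ P, -1 ≠ s + x * t) :
    IsCone {z | ∃ s ∈ P, ∃ t ∈ P, z = s + x * t} where
  add := by
    rintro _ ⟨s, hs, t, ht, rfl⟩ _ ⟨s', hs', t', ht', rfl⟩
    exact ⟨s + s', h.add _ hs _ hs', t + t', h.add _ ht _ ht', by ring⟩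
  mul := by
    rintro _ ⟨s, hs, t, ht, rfl⟩ _ ⟨s', hs', t', ht', rfl⟩
    exact ⟨s * s' + (x * x) * (t * t'), h.add _ (h.mul _ hs _ hs') _ (h.mul _ (h.sq x) _ (h.mul _ ht _ ht')),
      s * t' + t * s', h.add _ (h.mul _ hs _ ht') _ (h.mul _ ht _ hs'), by ring⟩
  sq := fun y => ⟨y * y, h.sq y, 0, h.zero, by ring⟩
  neg := by
    rintro ⟨s, hs, t, ht, he⟩
    exact hx s hs t ht he

/-- maximality -/
def MaxCone {A : Type} [CommRing A] (Q : Set A) : Prop :=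
  IsCone Q ∧ ∀ Q', IsCone Q' → Q ⊆ Q' → Q' ⊆ Q

theorem MaxCone.of_notMem {A : Type} [CommRing A] {Q : Set A} (h : MaxCone Q) (x : A)
    (hx : x ∉ Q) : ∃ s ∈ Q, ∃ t ∈ Q, -1 = s + x * t := by
  by_contra hcon
  push Not at hcon
  refine hx (h.2 _ (h.1.adjoin x hcon) ?_ ⟨0, h.1.zero, 1, h.1.one, by ring⟩)
  intro z hz
  exact ⟨z, hz, 0, h.1.zero, by ring⟩

theorem MaxCone.total {A : Type} [CommRing A] {Q : Set A} (h : MaxCone Q) (x : A) :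
    x ∈ Q ∨ -x ∈ Q := by
  by_contra hcon
  push Not at hcon
  obtain ⟨s, hs, t, ht, e1⟩ := h.of_notMem x hcon.1
  obtain ⟨s', hs', t', ht', e2⟩ := h.of_notMem (-x) hcon.2
  apply h.1.neg
  have : (-1 : A) = (s + s' + s * s') + (x * x) * (t * t') := by
    linear_combination (1 + s') * e1 - x * t * e2
  rw [this]
  exact h.1.add _ (h.1.add _ (h.1.add _ hs _ hs') _ (h.1.mul _ hs _ hs')) _
    (h.1.mul _ (h.1.sq x) _ (h.1.mul _ ht _ ht'))

theorem IsCone.exists_max {A : Type} [CommRing A] {P : Set A} (h : IsCone P) :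
    ∃ Q, P ⊆ Q ∧ MaxCone Q := by
  obtain ⟨Q, hQ, hm⟩ := zorn_le_nonempty₀ {Q : Set A | IsCone Q} (by
    intro c hc hch y hy
    refine ⟨⋃₀ c, ?_, fun z hz => Set.subset_sUnion_of_mem hz⟩
    refine ⟨?_, ?_, fun x => ⟨y, hy, (hc hy).sq x⟩, ?_⟩
    · rintro x ⟨s, hs, hxs⟩ z ⟨t, ht, hzt⟩
      rcases hch.total hs ht with hst | hst
      · exact ⟨t, ht, (hc ht).add _ (hst hxs) _ hzt⟩
      · exact ⟨s, hs, (hc hs).add _ hxs _ (hst hzt)⟩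
    · rintro x ⟨s, hs, hxs⟩ z ⟨t, ht, hzt⟩
      rcases hch.total hs ht with hst | hst
      · exact ⟨t, ht, (hc ht).mul _ (hst hxs) _ hzt⟩
      · exact ⟨s, hs, (hc hs).mul _ hxs _ (hst hzt)⟩
    · rintro ⟨s, hs, hxs⟩
      exact (hc hs).neg hxs) P h
  exact ⟨Q, hQ, hm.prop, fun Q' h1 h2 => hm.le_of_ge h1 h2⟩

def MaxCone.supp {A : Type} [CommRing A] {Q : Set A} (h : MaxCone Q) : Ideal A where
  carrier := {x | x ∈ Q ∧ -x ∈ Q}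
  add_mem' := by
    rintro a b ⟨h1, h2⟩ ⟨h3, h4⟩
    exact ⟨h.1.add _ h1 _ h3, by rw [neg_add]; exact h.1.add _ h2 _ h4⟩
  zero_mem' := ⟨h.1.zero, by rw [neg_zero]; exact h.1.zero⟩
  smul_mem' := by
    rintro c x ⟨h1, h2⟩
    rcases h.total c with hc | hc
    · exact ⟨h.1.mul _ hc _ h1, by
        have := h.1.mul _ hc _ h2
        rwa [mul_neg] at this⟩
    · constructor
      · have := h.1.mul _ hc _ h2
        rwa [neg_mul_neg] at this
      · have := h.1.mul _ hc _ h1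
        rwa [neg_mul] at this

theorem MaxCone.supp_prime {A : Type} [CommRing A] {Q : Set A} (h : MaxCone Q) :
    h.supp.IsPrime := by
  have hc : ∀ x, x ∉ h.supp → ∃ s ∈ Q, ∃ t ∈ Q, ∃ e : A, 1 + s = x * e := by
    intro x hx
    by_cases h1 : x ∈ Q
    · have h2 : -x ∉ Q := fun h2 => hx ⟨h1, h2⟩
      obtain ⟨s, hs, t, ht, e⟩ := h.of_notMem _ h2
      exact ⟨s, hs, t, ht, t, by linear_combination -e⟩
    · obtain ⟨s, hs, t, ht, e⟩ := h.of_notMem _ h1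
      exact ⟨s, hs, t, ht, -t, by linear_combination -e⟩
  refine ⟨?_, ?_⟩
  · rw [Ideal.ne_top_iff_one]
    exact fun h1 => h.1.neg h1.2
  · intro x y hxy
    by_contra hcon
    push Not at hcon
    obtain ⟨s, hs, -, -, e, he⟩ := hc x hcon.1
    obtain ⟨s', hs', -, -, e', he'⟩ := hc y hcon.2
    have hm : x * y * (e * e') ∈ h.supp := h.supp.mul_mem_right _ hxy
    have h2 : -(x * y * (e * e')) ∈ Q := hm.2
    apply h.1.neg
    have : (-1 : A) = (s + s' + s * s') + -(x * y * (e * e')) := by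
      linear_combination (- (1 + s')) * he - x * e * he'
    rw [this]
    exact h.1.add _ (h.1.add _ (h.1.add _ hs _ hs') _ (h.1.mul _ hs _ hs')) _ h2

theorem exists_linearOrder_of_cone {K : Type} [Field K] (Q : Set K) (hQ : IsCone Q)
    (ht : ∀ x, x ∈ Q ∨ -x ∈ Q) :
    ∃ (_ : LinearOrder K) (_ : IsStrictOrderedRing K), ∀ x : K, 0 ≤ x ↔ x ∈ Q := by
  classical
  have hz : ∀ x, x ∈ Q → -x ∈ Q → x = 0 := by
    intro x h1 h2
    by_contra h0
    apply hQ.neg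
    have : (-1 : K) = (-x * x) * (x⁻¹ * x⁻¹) := by field_simp
    rw [this]
    exact hQ.mul _ (hQ.mul _ h2 _ h1) _ (hQ.sq _)
  letI L : LinearOrder K :=
    { le := fun x y => y - x ∈ Q
      le_refl := fun x => by change x - x ∈ Q; rw [sub_self]; exact hQ.zero
      le_trans := fun x y z h1 h2 => by
        change z - x ∈ Q
        have := hQ.add _ h2 _ h1
        rwa [sub_add_sub_cancel] at this
      le_antisymm := fun x y h1 h2 => by
        have h1 : y - x ∈ Q := h1
        have h2 : x - y ∈ Q := h2
        have := hz _ h2 (by rwa [neg_sub])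
        exact sub_eq_zero.1 this
      le_total := fun x y => by
        rcases ht (y - x) with h | h
        · exact Or.inl h
        · right; rw [neg_sub] at h; exact h
      toDecidableLE := Classical.decRel _ }
  have hle : ∀ x y : K, x ≤ y ↔ y - x ∈ Q := fun _ _ => Iff.rfl
  have : IsOrderedAddMonoid K := ⟨fun a b h c => by rw [hle] at *; simpa using h,
    fun a b h c => by rw [hle] at *; simpa using h⟩
  have : ZeroLEOneClass K := ⟨by rw [hle]; simpa using hQ.one⟩
  have : IsOrderedRing K := .of_mul_nonneg fun a b ha hb => by
    rw [hle] at *; simp only [sub_zero] at *; exact hQ.mul _ ha _ hb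
  have : IsStrictOrderedRing K := IsOrderedRing.toIsStrictOrderedRing K
  exact ⟨L, this, fun x => by rw [hle, sub_zero]⟩

section signlemma
variable {K : Type} [Field K] [LinearOrder K] [IsStrictOrderedRing K]

variable (K) in
noncomputable def WS : AddSubmonoid (Polynomial K) :=
  AddSubmonoid.closure {w | ∃ (c : K) (g : Polynomial K), 0 ≤ c ∧ w = Polynomial.C c * (g * g)}

theorem WS_eval {w : Polynomial K} (hw : w ∈ WS K) (x : K) : 0 ≤ w.eval x := by
  induction hw using AddSubmonoid.closure_induction with
  | mem w h =>
    obtain ⟨c, g, hc, rfl⟩ := h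
    simp only [Polynomial.eval_mul, Polynomial.eval_C]
    exact mul_nonneg hc (mul_self_nonneg _)
  | zero => simp
  | add a b _ _ ha hb => rw [Polynomial.eval_add]; exact add_nonneg ha hb

theorem WS_mul {w z : Polynomial K} (hw : w ∈ WS K) (hz : z ∈ WS K) : w * z ∈ WS K := by
  induction hw using AddSubmonoid.closure_induction with
  | zero => rw [zero_mul]; exact (WS K).zero_mem
  | add a b _ _ ha hb => rw [add_mul]; exact (WS K).add_mem ha hb
  | mem w h =>
    obtain ⟨c, g, hc, rfl⟩ := h
    induction hz using AddSubmonoid.closure_induction with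
    | zero => rw [mul_zero]; exact (WS K).zero_mem
    | add a b _ _ ha hb => rw [mul_add]; exact (WS K).add_mem ha hb
    | mem w h =>
      obtain ⟨c', g', hc', rfl⟩ := h
      apply AddSubmonoid.subset_closure
      exact ⟨c * c', g * g', mul_nonneg hc hc', by rw [Polynomial.C_mul]; ring⟩

theorem WS_reduce (p : Polynomial K) (hp : p.natDegree ≠ 0) {w : Polynomial K} (hw : w ∈ WS K) :
    ∃ w' ∈ WS K, w'.natDegree ≤ 2 * (p.natDegree - 1) ∧ p ∣ w - w' := by
  induction hw using AddSubmonoid.closure_induction with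
  | zero => exact ⟨0, (WS K).zero_mem, by simp, by simp⟩
  | add a b _ _ ha hb =>
    obtain ⟨a', h1, h2, h3⟩ := ha
    obtain ⟨b', g1, g2, g3⟩ := hb
    refine ⟨a' + b', (WS K).add_mem h1 g1, ?_, ?_⟩
    · exact (Polynomial.natDegree_add_le _ _).trans (max_le h2 g2)
    · have : a + b - (a' + b') = (a - a') + (b - b') := by ring
      rw [this]; exact dvd_add h3 g3
  | mem w h =>
    obtain ⟨c, g, hc, rfl⟩ := h
    have hd : p ∣ g - g % p := ⟨g / p, by
      have := EuclideanDomain.div_add_mod g p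
      linear_combination -this⟩
    refine ⟨Polynomial.C c * ((g % p) * (g % p)), AddSubmonoid.subset_closure ⟨c, _, hc, rfl⟩, ?_, ?_⟩
    · have h1 : (g % p).natDegree < p.natDegree := Polynomial.natDegree_mod_lt g hp
      refine (Polynomial.natDegree_C_mul_le _ _).trans ?_
      refine (Polynomial.natDegree_mul_le).trans ?_
      omega
    · have : Polynomial.C c * (g * g) - Polynomial.C c * ((g % p) * (g % p)) =
          (g - g % p) * (Polynomial.C c * (g + g % p)) := by ring
      rw [this]; exact dvd_mul_of_dvd_left hd _

theorem sign_change_not_dvd (a b : K) (n : ℕ) : ∀ (p w : Polynomial K), p.natDegree = n →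
    p.eval a * p.eval b < 0 → w ∈ WS K → ¬ p ∣ 1 + w := by
  induction n using Nat.strong_induction_on with
  | _ n ih =>
    intro p w hpn hab hw hdvd
    have hp : p.natDegree ≠ 0 := by
      intro h0
      rw [Polynomial.eq_C_of_natDegree_eq_zero h0] at hab
      simp only [Polynomial.eval_C] at hab
      exact absurd (mul_self_nonneg (p.coeff 0)) (not_le.2 hab)
    obtain ⟨w', hw', hdeg, hd⟩ := WS_reduce p hp hw
    have hd' : p ∣ 1 + w' := by
      have : 1 + w' = (1 + w) - (w - w') := by ring
      rw [this]; exact dvd_sub hdvd hd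
    obtain ⟨q, hq⟩ := hd'
    have hpos : ∀ x, 0 < (1 + w').eval x := by
      intro x
      rw [Polynomial.eval_add, Polynomial.eval_one]
      have := WS_eval hw' x
      linarith
    have hne : (1 + w') ≠ 0 := by
      intro h0; have := hpos 0; rw [h0] at this; simp at this
    have hp0 : p ≠ 0 := by rintro rfl; simp at hp
    have hq0 : q ≠ 0 := by rintro rfl; rw [mul_zero] at hq; exact hne hq
    have hdeg2 : p.natDegree + q.natDegree ≤ 2 * (p.natDegree - 1) := by
      rw [← Polynomial.natDegree_mul hp0 hq0, ← hq]
      refine (Polynomial.natDegree_add_le _ _).trans (max_le (by simp) hdeg)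
    refine ih q.natDegree (by omega) q w' rfl ?_ hw' ⟨p, by rw [hq]; ring⟩
    have h1 := hpos a
    have h2 := hpos b
    rw [hq, Polynomial.eval_mul] at h1 h2
    by_contra hcon
    rw [not_lt] at hcon
    have h3 := mul_pos h1 h2
    have h4 : p.eval a * q.eval a * (p.eval b * q.eval b) =
      (p.eval a * p.eval b) * (q.eval a * q.eval b) := by ring
    rw [h4] at h3
    exact absurd h3 (not_lt.2 (mul_nonpos_of_nonpos_of_nonneg hab.le hcon))

end signlemma


structure RelCone {Ω : Type} [Field Ω] (L : Subfield Ω) (C : Set Ω) : Prop where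
  sub : ∀ x ∈ C, x ∈ L
  add : ∀ x ∈ C, ∀ y ∈ C, x + y ∈ C
  mul : ∀ x ∈ C, ∀ y ∈ C, x * y ∈ C
  sq : ∀ x ∈ L, x * x ∈ C
  neg : -1 ∉ C

theorem RelCone.exists_max {Ω : Type} [Field Ω] {L : Subfield Ω} {C : Set Ω} (h : RelCone L C) :
    ∃ (L' : Subfield Ω) (C' : Set Ω), L ≤ L' ∧ C ⊆ C' ∧ RelCone L' C' ∧
      ∀ L'' C'', RelCone L'' C'' → L' ≤ L'' → C' ⊆ C'' → L'' ≤ L' ∧ C'' ⊆ C' := by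
  obtain ⟨⟨L', C'⟩, hle, hm⟩ := zorn_le_nonempty₀
    {p : Subfield Ω × Set Ω | RelCone p.1 p.2} (by
    intro c hc hch y hy
    have hdir : DirectedOn (· ≤ ·) (Prod.fst '' c) := by
      rintro _ ⟨s, hs, rfl⟩ _ ⟨t, ht, rfl⟩
      rcases hch.total hs ht with hst | hst
      · exact ⟨t.1, ⟨t, ht, rfl⟩, hst.1, le_rfl⟩
      · exact ⟨s.1, ⟨s, hs, rfl⟩, le_rfl, hst.1⟩
    have hmem : ∀ x, x ∈ sSup (Prod.fst '' c) ↔ ∃ s ∈ c, x ∈ s.1 := by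
      intro x
      rw [Subfield.mem_sSup_of_directedOn (Set.Nonempty.image _ ⟨y, hy⟩) hdir]
      simp only [Set.exists_mem_image]
    refine ⟨(sSup (Prod.fst '' c), ⋃₀ (Prod.snd '' c)), ?_, fun z hz =>
      ⟨le_sSup ⟨z, hz, rfl⟩, Set.subset_sUnion_of_mem ⟨z, hz, rfl⟩⟩⟩
    refine ⟨?_, ?_, ?_, ?_, ?_⟩
    · rintro x ⟨_, ⟨s, hs, rfl⟩, hxs⟩
      exact (hmem x).2 ⟨s, hs, (hc hs).sub _ hxs⟩
    · rintro x ⟨_, ⟨s, hs, rfl⟩, hxs⟩ z ⟨_, ⟨t, ht, rfl⟩, hzt⟩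
      rcases hch.total hs ht with hst | hst
      · exact ⟨t.2, ⟨t, ht, rfl⟩, (hc ht).add _ (hst.2 hxs) _ hzt⟩
      · exact ⟨s.2, ⟨s, hs, rfl⟩, (hc hs).add _ hxs _ (hst.2 hzt)⟩
    · rintro x ⟨_, ⟨s, hs, rfl⟩, hxs⟩ z ⟨_, ⟨t, ht, rfl⟩, hzt⟩
      rcases hch.total hs ht with hst | hst
      · exact ⟨t.2, ⟨t, ht, rfl⟩, (hc ht).mul _ (hst.2 hxs) _ hzt⟩
      · exact ⟨s.2, ⟨s, hs, rfl⟩, (hc hs).mul _ hxs _ (hst.2 hzt)⟩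
    · intro x hx
      obtain ⟨s, hs, hxs⟩ := (hmem x).1 hx
      exact ⟨s.2, ⟨s, hs, rfl⟩, (hc hs).sq x hxs⟩
    · rintro ⟨_, ⟨s, hs, rfl⟩, hxs⟩
      exact (hc hs).neg hxs) (L, C) h
  exact ⟨L', C', hle.1, hle.2, hm.prop, fun L'' C'' h1 h2 h3 =>
    hm.le_of_ge (y := (L'', C'')) h1 ⟨h2, h3⟩⟩

theorem RelCone.maxCone {Ω : Type} [Field Ω] {L : Subfield Ω} {C : Set Ω} (h : RelCone L C)
    (hm : ∀ L'' C'', RelCone L'' C'' → L ≤ L'' → C ⊆ C'' → L'' ≤ L ∧ C'' ⊆ C) :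
    MaxCone {l : L | (l : Ω) ∈ C} := by
  refine ⟨⟨fun x hx y hy => h.add _ hx _ hy, fun x hx y hy => h.mul _ hx _ hy,
    fun x => h.sq _ x.2, fun hx => h.neg (by simpa using hx)⟩, ?_⟩
  intro Q' hQ' hsub x hx
  have hR : RelCone L (Subtype.val '' Q') := by
    refine ⟨?_, ?_, ?_, ?_, ?_⟩
    · rintro _ ⟨y, -, rfl⟩; exact y.2
    · rintro _ ⟨y, hy, rfl⟩ _ ⟨z, hz, rfl⟩; exact ⟨y + z, hQ'.add _ hy _ hz, rfl⟩
    · rintro _ ⟨y, hy, rfl⟩ _ ⟨z, hz, rfl⟩; exact ⟨y * z, hQ'.mul _ hy _ hz, rfl⟩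
    · intro y hy; exact ⟨⟨y, hy⟩ * ⟨y, hy⟩, hQ'.sq _, rfl⟩
    · rintro ⟨y, hy, e⟩
      have : y = -1 := Subtype.ext (by simpa using e)
      rw [this] at hy
      exact hQ'.neg hy
  refine (hm _ _ hR le_rfl ?_).2 ⟨x, hx, rfl⟩
  intro y hy
  exact ⟨⟨y, h.sub _ hy⟩, hsub hy, rfl⟩

theorem RelCone.ivt {Ω : Type} [Field Ω] [IsAlgClosed Ω] {L : Subfield Ω} {C : Set Ω}
    (hm : ∀ L'' C'', RelCone L'' C'' → L ≤ L'' → C ⊆ C'' → L'' ≤ L ∧ C'' ⊆ C)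
    (hC : ∀ x ∈ C, x ∈ L)
    [LinearOrder L] [IsStrictOrderedRing L] (hle : ∀ x : L, 0 ≤ x ↔ (x : Ω) ∈ C) :
    IVTField L := by
  have key : ∀ (n : ℕ) (p : Polynomial L) (a b : L), p.natDegree = n → a < b →
      p.eval a * p.eval b < 0 → ∃ c, a < c ∧ c < b ∧ p.eval c = 0 := by
    intro n
    induction n using Nat.strong_induction_on with
    | _ n ih =>
    intro p a b hpn hab hs
    have hp0 : p ≠ 0 := by rintro rfl; simp at hs
    have hpd : p.natDegree ≠ 0 := by
      intro h0
      rw [Polynomial.eq_C_of_natDegree_eq_zero h0] at hs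
      simp only [Polynomial.eval_C] at hs
      exact absurd (mul_self_nonneg (p.coeff 0)) (not_le.2 hs)
    have hnu : ¬ IsUnit p := fun hu => hpd (Polynomial.natDegree_eq_zero_of_isUnit hu)
    by_cases hirr : Irreducible p
    · -- irreducible case
      obtain ⟨θ, hθ⟩ := IsAlgClosed.exists_aeval_eq_zero Ω p (by
        intro h; exact hpd (Polynomial.natDegree_eq_of_degree_eq_some h))
      have halg : IsAlgebraic L θ := ⟨p, hp0, hθ⟩
      have hdvd : ∀ g : Polynomial L, Polynomial.aeval θ g = 0 → p ∣ g := by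
        intro g hg
        have h1 : minpoly L θ ∣ g := minpoly.dvd _ _ hg
        have h2 : minpoly L θ ∣ p := minpoly.dvd _ _ hθ
        have h3 : Associated (minpoly L θ) p :=
          (minpoly.irreducible halg.isIntegral).associated_of_dvd hirr h2
        exact h3.dvd_iff_dvd_left.1 h1
      have hrange : ∀ x, x ∈ (IntermediateField.adjoin L {θ}).toSubfield ↔
          ∃ g : Polynomial L, Polynomial.aeval θ g = x := by
        intro x
        have : x ∈ (IntermediateField.adjoin L {θ}).toSubalgebra ↔
          ∃ g : Polynomial L, Polynomial.aeval θ g = x := by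
          rw [IntermediateField.adjoin_simple_toSubalgebra_of_isAlgebraic halg,
            Algebra.adjoin_singleton_eq_range_aeval]
          rfl
        exact this
      have hR : RelCone (IntermediateField.adjoin L {θ}).toSubfield
          ((fun w : Polynomial L => Polynomial.aeval θ w) '' (WS L : Set (Polynomial L))) := by
        refine ⟨?_, ?_, ?_, ?_, ?_⟩
        · rintro _ ⟨w, -, rfl⟩; exact (hrange _).2 ⟨w, rfl⟩
        · rintro _ ⟨w, hw, rfl⟩ _ ⟨z, hz, rfl⟩
          exact ⟨w + z, (WS L).add_mem hw hz, by simp⟩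
        · rintro _ ⟨w, hw, rfl⟩ _ ⟨z, hz, rfl⟩
          exact ⟨w * z, WS_mul hw hz, by simp⟩
        · intro x hx
          obtain ⟨g, rfl⟩ := (hrange x).1 hx
          exact ⟨g * g, AddSubmonoid.subset_closure ⟨1, g, zero_le_one, by simp⟩, by simp⟩
        · rintro ⟨w, hw, e⟩
          have e : Polynomial.aeval θ w = -1 := e
          refine sign_change_not_dvd a b _ p w rfl hs hw (hdvd _ ?_)
          rw [map_add, map_one, e]; ring
      have hmx := hm _ _ hR (by
          intro x hx
          exact (hrange x).2 ⟨Polynomial.C ⟨x, hx⟩, by rw [Polynomial.aeval_C]; rfl⟩) (by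
          intro x hx
          refine ⟨Polynomial.C ⟨x, hC x hx⟩, AddSubmonoid.subset_closure
            ⟨⟨x, hC x hx⟩, 1, (hle _).2 hx, by simp⟩, ?_⟩
          change Polynomial.aeval θ _ = x
          rw [Polynomial.aeval_C]; rfl)
      have hθL : θ ∈ L := hmx.1 ((hrange θ).2 ⟨Polynomial.X, by simp⟩)
      have hroot : Polynomial.aeval θ (Polynomial.X - Polynomial.C (⟨θ, hθL⟩ : L)) = 0 := by
        rw [map_sub, Polynomial.aeval_X, Polynomial.aeval_C]
        exact sub_self θ
      obtain ⟨q, hq⟩ := hdvd _ hroot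
      set t : L := ⟨θ, hθL⟩ with ht
      have hdeg : p.natDegree + q.natDegree = 1 := by
        have hq0 : q ≠ 0 := by
          rintro rfl; rw [mul_zero] at hq; exact Polynomial.X_sub_C_ne_zero _ hq
        rw [← Polynomial.natDegree_mul hp0 hq0, ← hq, Polynomial.natDegree_X_sub_C]
      have hq0 : q.natDegree = 0 := by omega
      rw [Polynomial.eq_C_of_natDegree_eq_zero hq0] at hq
      set k := q.coeff 0
      have hx : ∀ x : L, x - t = p.eval x * k := by
        intro x
        have := congrArg (Polynomial.eval x) hq
        simpa using this
      have hk : k ≠ 0 := by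
        intro h0
        have h1 := hx a; have h2 := hx b
        rw [h0, mul_zero] at h1 h2
        have : a = b := by linear_combination h1 - h2
        exact hab.ne this
      have hpr : (a - t) * (b - t) < 0 := by
        rw [hx a, hx b]
        have : p.eval a * k * (p.eval b * k) = (p.eval a * p.eval b) * (k * k) := by ring
        rw [this]
        exact mul_neg_of_neg_of_pos hs (mul_self_pos.2 hk)
      refine ⟨t, ?_, ?_, ?_⟩
      · by_contra hcon
        rw [not_lt] at hcon
        have := mul_nonneg (sub_nonneg.2 hcon) (sub_nonneg.2 (hcon.trans hab.le))
        exact absurd this (not_le.2 hpr)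
      · by_contra hcon
        rw [not_lt] at hcon
        have := mul_nonneg_of_nonpos_of_nonpos (sub_nonpos.2 (hab.le.trans hcon)) (sub_nonpos.2 hcon)
        exact absurd this (not_le.2 hpr)
      · have := hx t
        rw [sub_self] at this
        exact (mul_eq_zero.1 this.symm).resolve_right hk
    · -- reducible case
      rw [irreducible_iff] at hirr
      push Not at hirr
      obtain ⟨q, r, hqr, hqu, hru⟩ := hirr hnu
      have hq0 : q ≠ 0 := by rintro rfl; rw [zero_mul] at hqr; exact hp0 hqr
      have hr0 : r ≠ 0 := by rintro rfl; rw [mul_zero] at hqr; exact hp0 hqr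
      have hdeg : q.natDegree + r.natDegree = n := by
        rw [← Polynomial.natDegree_mul hq0 hr0, ← hqr, hpn]
      have hqd : q.natDegree ≠ 0 := by
        intro h; apply hqu
        rw [Polynomial.isUnit_iff_degree_eq_zero, Polynomial.degree_eq_natDegree hq0, h]; rfl
      have hrd : r.natDegree ≠ 0 := by
        intro h; apply hru
        rw [Polynomial.isUnit_iff_degree_eq_zero, Polynomial.degree_eq_natDegree hr0, h]; rfl
      have hs' : (q.eval a * q.eval b) * (r.eval a * r.eval b) < 0 := by
        rw [hqr, Polynomial.eval_mul, Polynomial.eval_mul] at hs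
        calc _ = _ := by ring
          _ < 0 := hs
      rcases mul_neg_iff.1 hs' with ⟨-, h⟩ | ⟨h, -⟩
      · obtain ⟨c, h1, h2, h3⟩ := ih _ (by omega) r a b rfl hab h
        exact ⟨c, h1, h2, by rw [hqr, Polynomial.eval_mul, h3, mul_zero]⟩
      · obtain ⟨c, h1, h2, h3⟩ := ih _ (by omega) q a b rfl hab h
        exact ⟨c, h1, h2, by rw [hqr, Polynomial.eval_mul, h3, zero_mul]⟩
  intro p a b hab hs
  exact key _ p a b rfl hab hs

theorem exists_real_hom {A : Type} [CommRing A] (P : Set A) (hP : IsCone P) :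
    ∃ (R : Type) (_ : Field R) (_ : LinearOrder R) (_ : IsStrictOrderedRing R),
      IVTField R ∧ ∃ φ : A →+* R, ∀ a ∈ P, 0 ≤ φ a := by
  obtain ⟨Q, hPQ, hQ⟩ := hP.exists_max
  have hpr := hQ.supp_prime
  let F := FractionRing (A ⧸ hQ.supp)
  let Ω := AlgebraicClosure F
  let φ1 : A →+* F := (algebraMap (A ⧸ hQ.supp) F).comp (Ideal.Quotient.mk hQ.supp)
  let φ0 : A →+* Ω := (algebraMap F Ω).comp φ1
  have hφ1 : ∀ a, φ1 a = 0 ↔ a ∈ hQ.supp := by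
    intro a
    rw [← Ideal.Quotient.eq_zero_iff_mem]
    change algebraMap (A ⧸ hQ.supp) F _ = 0 ↔ _
    exact map_eq_zero_iff _ (IsFractionRing.injective (A ⧸ hQ.supp) F)
  have hφ0 : ∀ a, φ0 a = 0 ↔ a ∈ hQ.supp := by
    intro a
    rw [← hφ1]
    change algebraMap F Ω _ = 0 ↔ _
    exact map_eq_zero _
  have hmemL : ∀ a, φ0 a ∈ (algebraMap F Ω).fieldRange := fun a => ⟨φ1 a, rfl⟩
  have hfrac : ∀ w ∈ (algebraMap F Ω).fieldRange, ∃ a b, φ0 b ≠ 0 ∧ w * φ0 b = φ0 a := by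
    rintro _ ⟨x, rfl⟩
    obtain ⟨u, v, hv, rfl⟩ := IsFractionRing.div_surjective (A := A ⧸ hQ.supp) x
    obtain ⟨a, rfl⟩ := Ideal.Quotient.mk_surjective u
    obtain ⟨b, rfl⟩ := Ideal.Quotient.mk_surjective v
    have hb : φ1 b ≠ 0 := by
      intro h
      rw [hφ1, ← Ideal.Quotient.eq_zero_iff_mem] at h
      exact nonZeroDivisors.ne_zero hv h
    refine ⟨a, b, ?_, ?_⟩
    · change algebraMap F Ω (φ1 b) ≠ 0
      simpa using hb
    · change algebraMap F Ω (φ1 a / φ1 b) * algebraMap F Ω (φ1 b) = algebraMap F Ω (φ1 a)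
      rw [← map_mul, div_mul_cancel₀ _ hb]
  have hC0 : RelCone (algebraMap F Ω).fieldRange
      {w | w ∈ (algebraMap F Ω).fieldRange ∧ ∃ q ∈ Q, ∃ b, φ0 b ≠ 0 ∧ w * (φ0 b * φ0 b) = φ0 q} := by
    refine ⟨fun x hx => hx.1, ?_, ?_, ?_, ?_⟩
    · rintro x ⟨hx, q, hq, b, hb, e⟩ y ⟨hy, q', hq', b', hb', e'⟩
      refine ⟨add_mem hx hy, q * (b' * b') + q' * (b * b), hQ.1.add _ (hQ.1.mul _ hq _ (hQ.1.sq _)) _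
        (hQ.1.mul _ hq' _ (hQ.1.sq _)), b * b', by rw [map_mul]; exact mul_ne_zero hb hb', ?_⟩
      simp only [map_mul, map_add]
      rw [← e, ← e']; ring
    · rintro x ⟨hx, q, hq, b, hb, e⟩ y ⟨hy, q', hq', b', hb', e'⟩
      refine ⟨mul_mem hx hy, q * q', hQ.1.mul _ hq _ hq',
        b * b', by rw [map_mul]; exact mul_ne_zero hb hb', ?_⟩
      simp only [map_mul]
      rw [← e, ← e']; ring
    · intro x hx
      obtain ⟨a, b, hb, e⟩ := hfrac x hx
      refine ⟨mul_mem hx hx, a * a, hQ.1.sq _, b, hb, ?_⟩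
      rw [map_mul, ← e]; ring
    · rintro ⟨-, q, hq, b, hb, e⟩
      have h0 : φ0 (q + b * b) = 0 := by
        rw [map_add, map_mul, ← e]; ring
      rw [hφ0] at h0
      have h1 : -(q + b * b) ∈ Q := h0.2
      have h2 : -(b * b) ∈ Q := by
        have := hQ.1.add _ h1 _ hq
        convert this using 1; ring
      have h3 : b * b ∈ hQ.supp := ⟨hQ.1.sq b, h2⟩
      rw [← hφ0, map_mul] at h3
      exact mul_ne_zero hb hb h3
  obtain ⟨L, C, hL, hCC, hR, hm⟩ := hC0.exists_max
  have hmax := hR.maxCone hm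
  obtain ⟨i1, i2, hle⟩ := exists_linearOrder_of_cone _ hmax.1 hmax.total
  refine ⟨L, inferInstance, i1, i2, RelCone.ivt hm hR.sub hle,
    φ0.codRestrict L (fun a => hL (hmemL a)), ?_⟩
  intro a ha
  rw [hle]
  change φ0 a ∈ C
  refine hCC ⟨hmemL a, a, hPQ ha, 1, ?_, ?_⟩
  · simp
  · simp


theorem isSOS_iff {d : ℕ} (p : MvPolynomial (Fin d) ℝ) : IsSOS p ↔ IsSumSq p := by
  constructor
  · rintro ⟨k, q, rfl⟩
    refine IsSumSq.sum fun i _ => ?_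
    rw [sq]; exact IsSumSq.mul_self _
  · intro h
    induction h with
    | zero => exact ⟨0, Fin.elim0, by simp⟩
    | sq_add a _ ih =>
      obtain ⟨k, q, rfl⟩ := ih
      refine ⟨k + 1, Fin.cons a q, ?_⟩
      rw [Fin.sum_univ_succ]; simp [sq]

structure PreCone {A : Type} [CommRing A] (P : Set A) : Prop where
  add : ∀ x ∈ P, ∀ y ∈ P, x + y ∈ P
  mul : ∀ x ∈ P, ∀ y ∈ P, x * y ∈ P
  sq : ∀ x, x * x ∈ P

theorem PreCone.zero {A : Type} [CommRing A] {P : Set A} (h : PreCone P) : 0 ∈ P := by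
  simpa using h.sq 0

theorem PreCone.one {A : Type} [CommRing A] {P : Set A} (h : PreCone P) : 1 ∈ P := by
  simpa using h.sq 1

theorem PreCone.sum {A ι : Type} [CommRing A] {P : Set A} (h : PreCone P) (s : Finset ι)
    (f : ι → A) (hf : ∀ i ∈ s, f i ∈ P) : ∑ i ∈ s, f i ∈ P := by
  classical
  induction s using Finset.induction_on with
  | empty => simpa using h.zero
  | insert a s ha ih =>
    rw [Finset.sum_insert ha]
    exact h.add _ (hf _ (by simp)) _ (ih fun i hi => hf i (by simp [hi]))

theorem PreCone.sumSq {A : Type} [CommRing A] {P : Set A} (h : PreCone P) {x : A}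
    (hx : IsSumSq x) : x ∈ P := by
  induction hx with
  | zero => exact h.zero
  | sq_add a _ ih => exact h.add _ (h.sq a) _ ih

theorem PreCone.const {d : ℕ} {P : Set (MvPolynomial (Fin d) ℝ)} (h : PreCone P) {c : ℝ}
    (hc : 0 ≤ c) : C c ∈ P := by
  have := h.sq (C (Real.sqrt c))
  rwa [← C_mul, Real.mul_self_sqrt hc] at this

theorem preordering_term {d m : ℕ} (a : Fin m → MvPolynomial (Fin d) ℝ)
    (T : Finset (Fin m)) (σ : MvPolynomial (Fin d) ℝ) (hσ : IsSumSq σ) :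
    σ * ∏ i ∈ T, a i ∈ Preordering a := by
  classical
  refine ⟨fun U => if U = T then σ else 0, ?_, ?_⟩
  · intro U
    rw [isSOS_iff]
    dsimp only
    split_ifs
    · exact hσ
    · exact IsSumSq.zero
  · simp [ite_mul]

theorem preordering_add {d m : ℕ} (a : Fin m → MvPolynomial (Fin d) ℝ) :
    ∀ x ∈ Preordering a, ∀ y ∈ Preordering a, x + y ∈ Preordering a := by
  rintro _ ⟨σ, hσ, rfl⟩ _ ⟨τ, hτ, rfl⟩
  refine ⟨fun T => σ T + τ T, fun T => ?_, ?_⟩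
  · rw [isSOS_iff]
    exact ((isSOS_iff _).1 (hσ T)).add ((isSOS_iff _).1 (hτ T))
  · rw [← Finset.sum_add_distrib]
    exact Finset.sum_congr rfl fun T _ => by ring

theorem preordering_sum {d m : ℕ} {ι : Type} (a : Fin m → MvPolynomial (Fin d) ℝ) (s : Finset ι)
    (f : ι → MvPolynomial (Fin d) ℝ) (hf : ∀ i ∈ s, f i ∈ Preordering a) :
    ∑ i ∈ s, f i ∈ Preordering a := by
  classical
  induction s using Finset.induction_on with
  | empty =>
    have := preordering_term a ∅ 0 IsSumSq.zero
    simpa using this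
  | insert i s ha ih =>
    rw [Finset.sum_insert ha]
    exact preordering_add a _ (hf _ (by simp)) _ (ih fun i hi => hf i (by simp [hi]))

theorem prod_mul_prod_symm {A ι : Type} [CommRing A] [DecidableEq ι] (a : ι → A) (S T : Finset ι) :
    (∏ i ∈ S, a i) * (∏ i ∈ T, a i) =
      ((∏ i ∈ S ∩ T, a i) * (∏ i ∈ S ∩ T, a i)) * ∏ i ∈ (S \ T) ∪ (T \ S), a i := by
  rw [Finset.prod_union (disjoint_sdiff_sdiff)]
  have h1 := Finset.prod_inter_mul_prod_diff S T a
  have h2 := Finset.prod_inter_mul_prod_diff T S a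
  rw [Finset.inter_comm T S] at h2
  rw [← h1, ← h2]; ring

theorem preordering_preCone {d m : ℕ} (a : Fin m → MvPolynomial (Fin d) ℝ) :
    PreCone (Preordering a) := by
  classical
  refine ⟨preordering_add a, ?_, ?_⟩
  · rintro _ ⟨σ, hσ, rfl⟩ _ ⟨τ, hτ, rfl⟩
    rw [Finset.sum_mul_sum]
    refine preordering_sum a _ _ fun S _ => preordering_sum a _ _ fun T _ => ?_
    have : σ S * (∏ i ∈ S, a i) * (τ T * ∏ i ∈ T, a i) =
      (σ S * τ T * ((∏ i ∈ S ∩ T, a i) * (∏ i ∈ S ∩ T, a i))) * ∏ i ∈ (S \ T) ∪ (T \ S), a i := by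
      linear_combination (σ S * τ T) * prod_mul_prod_symm a S T
    rw [this]
    apply preordering_term
    exact ((((isSOS_iff _).1 (hσ S)).mul ((isSOS_iff _).1 (hτ T)))).mul (IsSumSq.mul_self _)
  · intro x
    have := preordering_term a ∅ (x * x) (IsSumSq.mul_self _)
    simpa using this

theorem preordering_mem {d m : ℕ} (a : Fin m → MvPolynomial (Fin d) ℝ) (j : Fin m) :
    a j ∈ Preordering a := by
  have := preordering_term a {j} (1 * 1) (IsSumSq.mul_self _)
  simpa using this

theorem wpss {d m : ℕ} (a : Fin m → MvPolynomial (Fin d) ℝ) (h : MvPolynomial (Fin d) ℝ)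
    (hpos : ∀ x : Fin d → ℝ, (∀ j, 0 ≤ eval x (a j)) → 0 < eval x h) :
    ∃ s ∈ Preordering a, ∃ t ∈ Preordering a, t * h = 1 + s := by
  classical
  have hP := preordering_preCone a
  by_cases hneg : -1 ∈ Preordering a
  · exact ⟨-1, hneg, 0, hP.zero, by ring⟩
  have hc : IsCone (Preordering a) := ⟨hP.add, hP.mul, hP.sq, hneg⟩
  by_contra hcon
  push Not at hcon
  have hc' := hc.adjoin (-h) (by
    intro s hs t ht e
    exact hcon s hs t ht (by linear_combination e))
  obtain ⟨R, i1, i2, i3, hR, φ, hφ⟩ := exists_real_hom _ hc'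
  obtain ⟨y, hy⟩ := artin_lang hR d φ (insert h (Finset.univ.image a))
  have h1 : ∀ j, 0 ≤ eval y (a j) := by
    intro j
    have := hy (a j) (by simp)
    have h2 := hφ (a j) ⟨a j, preordering_mem a j, 0, hP.zero, by ring⟩
    rw [← sign_nonneg_iff] at h2 ⊢
    rwa [this]
  have h2 := hpos y h1
  have h3 := hφ (-h) ⟨0, hP.zero, 1, hP.one, by ring⟩
  rw [map_neg, neg_nonneg, ← not_lt, ← sign_eq_one_iff, ← hy h (by simp), sign_eq_one_iff] at h3
  exact h3 h2

theorem arch_of_ball {d : ℕ} {T : Set (MvPolynomial (Fin d) ℝ)} (hT : PreCone T) (N : ℝ)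
    (hN : 0 ≤ N) (hg : C N - ∑ i, X i * X i ∈ T) (p : MvPolynomial (Fin d) ℝ) :
    ∃ k : ℝ, 0 ≤ k ∧ C k - p ∈ T ∧ C k + p ∈ T := by
  classical
  have hX : ∀ i, C N - X i * X i ∈ T := by
    intro i
    have h1 : ∑ j ∈ Finset.univ.erase i, (X j * X j : MvPolynomial (Fin d) ℝ) ∈ T :=
      hT.sum _ _ fun j _ => hT.sq _
    have h2 := hT.add _ hg _ h1
    rw [← Finset.add_sum_erase _ _ (Finset.mem_univ i)] at h2
    convert h2 using 1; ring
  have hmul : ∀ x y, (∃ k : ℝ, 0 ≤ k ∧ C k - x ∈ T ∧ C k + x ∈ T) →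
      (∃ k : ℝ, 0 ≤ k ∧ C k - y ∈ T ∧ C k + y ∈ T) →
      ∃ k : ℝ, 0 ≤ k ∧ C k - x * y ∈ T ∧ C k + x * y ∈ T := by
    rintro x y ⟨k, hk, k1, k2⟩ ⟨l, hl, l1, l2⟩
    have e : (C (1 / 2 : ℝ) : MvPolynomial (Fin d) ℝ) * 2 = 1 := by
      rw [show (2 : MvPolynomial (Fin d) ℝ) = C 2 from rfl, ← C_mul]; norm_num
    have hh : C (1 / 2 : ℝ) ∈ T := hT.const (by norm_num)
    refine ⟨k * l, mul_nonneg hk hl, ?_, ?_⟩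
    · have := hT.mul _ hh _ (hT.add _ (hT.mul _ k1 _ l2) _ (hT.mul _ k2 _ l1))
      convert this using 1
      rw [C_mul]
      linear_combination -(C k * C l - x * y) * e
    · have := hT.mul _ hh _ (hT.add _ (hT.mul _ k1 _ l1) _ (hT.mul _ k2 _ l2))
      convert this using 1
      rw [C_mul]
      linear_combination -(C k * C l + x * y) * e
  induction p using MvPolynomial.induction_on with
  | C c =>
    refine ⟨|c|, abs_nonneg _, ?_, ?_⟩
    · rw [← C_sub]; exact hT.const (sub_nonneg.2 (le_abs_self c))
    · rw [← C_add]; exact hT.const (by linarith [neg_abs_le c])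
  | add x y hx hy =>
    obtain ⟨k, hk, k1, k2⟩ := hx
    obtain ⟨l, hl, l1, l2⟩ := hy
    refine ⟨k + l, add_nonneg hk hl, ?_, ?_⟩
    · have := hT.add _ k1 _ l1
      convert this using 1
      rw [C_add]; ring
    · have := hT.add _ k2 _ l2
      convert this using 1
      rw [C_add]; ring
  | mul_X x i hx =>
    refine hmul x (X i) hx ⟨N + 1 / 4, by positivity, ?_, ?_⟩
    · have := hT.add _ (hX i) _ (hT.sq (X i - C (1 / 2)))
      convert this using 1
      rw [show (1 / 4 : ℝ) = 1 / 2 * (1 / 2) by norm_num, C_add, C_mul]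
      have e : (C (1 / 2 : ℝ) : MvPolynomial (Fin d) ℝ) * 2 = 1 := by
        rw [show (2 : MvPolynomial (Fin d) ℝ) = C 2 from rfl, ← C_mul]; norm_num
      linear_combination (X i) * e
    · have := hT.add _ (hX i) _ (hT.sq (X i + C (1 / 2)))
      convert this using 1
      rw [show (1 / 4 : ℝ) = 1 / 2 * (1 / 2) by norm_num, C_add, C_mul]
      have e : (C (1 / 2 : ℝ) : MvPolynomial (Fin d) ℝ) * 2 = 1 := by
        rw [show (2 : MvPolynomial (Fin d) ℝ) = C 2 from rfl, ← C_mul]; norm_num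
      linear_combination -(X i) * e

theorem ballCone {A : Type} [CommRing A] (g : A) :
    PreCone {z : A | ∃ s t, IsSumSq s ∧ IsSumSq t ∧ z = s + g * t} where
  add := by
    rintro _ ⟨s, t, hs, ht, rfl⟩ _ ⟨s', t', hs', ht', rfl⟩
    exact ⟨s + s', t + t', hs.add hs', ht.add ht', by ring⟩
  mul := by
    rintro _ ⟨s, t, hs, ht, rfl⟩ _ ⟨s', t', hs', ht', rfl⟩
    exact ⟨s * s' + g * g * (t * t'), s * t' + t * s',
      (hs.mul hs').add ((IsSumSq.mul_self g).mul (ht.mul ht')),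
      (hs.mul ht').add (ht.mul hs'), by ring⟩
  sq := fun x => ⟨x * x, 0, IsSumSq.mul_self x, IsSumSq.zero, by ring⟩

theorem woermann {d m : ℕ} (a : Fin m → MvPolynomial (Fin d) ℝ)
    (hbdd : Bornology.IsBounded {x : Fin d → ℝ | ∀ j, 0 ≤ eval x (a j)})
    (p : MvPolynomial (Fin d) ℝ) :
    ∃ k : ℝ, 0 ≤ k ∧ C k - p ∈ Preordering a ∧ C k + p ∈ Preordering a := by
  have hP := preordering_preCone a
  obtain ⟨r, hr⟩ := hbdd.subset_closedBall 0
  set N : ℝ := d * (r * r) + 1 with hNdef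
  have hN : 0 ≤ N := by
    have := mul_self_nonneg r
    positivity
  set g : MvPolynomial (Fin d) ℝ := C N - ∑ i, X i * X i with hgdef
  have hgpos : ∀ x : Fin d → ℝ, (∀ j, 0 ≤ eval x (a j)) → 0 < eval x g := by
    intro x hx
    have h1 := hr hx
    rw [mem_closedBall_zero_iff] at h1
    have h2 : ∑ i, x i * x i ≤ ∑ _i : Fin d, r * r := by
      refine Finset.sum_le_sum fun i _ => ?_
      have h3 := (norm_le_pi_norm x i).trans h1
      rw [Real.norm_eq_abs, abs_le] at h3
      nlinarith [h3.1, h3.2]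
    rw [Finset.sum_const, Finset.card_univ, Fintype.card_fin, nsmul_eq_mul] at h2
    simp only [hgdef, map_sub, eval_C, map_sum, map_mul, eval_X]
    linarith
  obtain ⟨s, hs, t, ht, e⟩ := wpss a g hgpos
  obtain ⟨k, hk, ⟨σ, τ, hσ, hτ, hk1⟩, -⟩ := arch_of_ball (ballCone g) N hN
    ⟨0, 1, IsSumSq.zero, by simpa using IsSumSq.mul_self (1 : MvPolynomial (Fin d) ℝ), by rw [hgdef]; ring⟩ s
  have h1s : 1 + s ∈ Preordering a := hP.add _ hP.one _ hs
  have hg1 : (1 + s) * g ∈ Preordering a := by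
    have : (1 + s) * g = t * (g * g) := by rw [← e]; ring
    rw [this]; exact hP.mul _ ht _ (hP.sq g)
  have h2 : (1 + s) * (C k - s) ∈ Preordering a := by
    have : (1 + s) * (C k - s) = (1 + s) * σ + (1 + s) * g * τ := by rw [hk1]; ring
    rw [this]
    exact hP.add _ (hP.mul _ h1s _ (hP.sumSq hσ)) _ (hP.mul _ hg1 _ (hP.sumSq hτ))
  set c : ℝ := k + k / 2 * (k / 2)
  have h3 : C c - s ∈ Preordering a := by
    have h4 := hP.add _ h2 _ (hP.sq (s - C (k / 2)))
    convert h4 using 1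
    have e2 : (C (k / 2 : ℝ) : MvPolynomial (Fin d) ℝ) * 2 = C k := by
      rw [show (2 : MvPolynomial (Fin d) ℝ) = C 2 from rfl, ← C_mul]; congr 1; ring
    simp only [c, C_add, C_mul]
    linear_combination s * e2
  have hc : 0 ≤ c := by positivity
  refine arch_of_ball hP (N + N * c) (by positivity) ?_ p
  have h5 := hP.add _ (hP.add _ hg1 _ (hP.mul _ hs _ (hP.sum Finset.univ
    (fun i => (X i * X i : MvPolynomial (Fin d) ℝ)) fun i _ => hP.sq _))) _
    (hP.mul _ (hP.const hN) _ h3)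
  convert h5 using 1
  rw [hgdef, C_add, C_mul]; ring

theorem final_step {d : ℕ} {P : Set (MvPolynomial (Fin d) ℝ)} (hP : PreCone P)
    (harch : ∀ p : MvPolynomial (Fin d) ℝ, ∃ k : ℝ, 0 ≤ k ∧ C k - p ∈ P ∧ C k + p ∈ P)
    (f t : MvPolynomial (Fin d) ℝ) (ht : t ∈ P) (hft : t * f - 1 ∈ P) : f ∈ P := by
  obtain ⟨k1, hk1, h1, -⟩ := harch t
  obtain ⟨k2, hk2, h2, -⟩ := harch (1 + t * t * f)
  set k : ℝ := k1 + k2 + 1 with hk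
  have hkpos : 0 < k := by positivity
  have g1 : C (2 * k) - t ∈ P := by
    have := hP.add _ h1 _ (hP.const (c := 2 * k - k1) (by linarith))
    convert this using 1
    rw [C_sub]; ring
  have g2 : C (2 * k) - 1 - t * t * f ∈ P := by
    have := hP.add _ h2 _ (hP.const (c := 2 * k - k2) (by linarith))
    convert this using 1
    rw [C_sub]; ring
  set δ : ℝ := k⁻¹ * k⁻¹ with hδ
  have hδ0 : 0 < δ := by positivity
  have step : ∀ r : ℝ, 0 ≤ r → f + C r ∈ P → f + C (r - δ) ∈ P := by
    intro r hr hfr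
    have := hP.mul _ (hP.const hδ0.le) _ (hP.add _ (hP.add _ (hP.add _
      (hP.mul _ (hP.sq (C k - t)) _ hfr) _
      (hP.mul _ (hP.const (c := 2 * k) (by positivity)) _ hft)) _
      (hP.mul _ (hP.const hr) _ (hP.mul _ ht _ g1))) _ g2)
    convert this using 1
    have e : (C δ : MvPolynomial (Fin d) ℝ) * (C k * C k) = 1 := by
      rw [← C_mul, ← C_mul, hδ, ← C_1]; congr 1; field_simp
    have e2 : (C (2 * k) : MvPolynomial (Fin d) ℝ) = 2 * C k := by
      rw [C_mul]; rfl
    rw [C_sub, e2]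
    linear_combination (-(f + C r)) * e
  have neg : ∀ r : ℝ, r ≤ 0 → f + C r ∈ P → f ∈ P := by
    intro r hr hfr
    have := hP.add _ hfr _ (hP.const (c := -r) (by linarith))
    rw [C_neg] at this
    convert this using 1; ring
  have iter : ∀ n : ℕ, ∀ r : ℝ, r ≤ n * δ → f + C r ∈ P → f ∈ P := by
    intro n
    induction n with
    | zero => intro r hr; exact neg r (by simpa using hr)
    | succ n ih =>
      intro r hr hfr
      rcases le_total r 0 with h0 | h0
      · exact neg r h0 hfr
      · refine ih (r - δ) ?_ (step r h0 hfr)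
        push_cast at hr; linarith
  obtain ⟨r, -, -, hr⟩ := harch f
  obtain ⟨n, hn⟩ := exists_nat_ge (r / δ)
  refine iter n r ?_ (by rwa [add_comm])
  rwa [div_le_iff₀ hδ0] at hn

theorem schmuedgen (d m : ℕ) (a : Fin m → MvPolynomial (Fin d) ℝ)
    (hne : {x : Fin d → ℝ | ∀ j, 0 ≤ eval x (a j)}.Nonempty)
    (hbdd : Bornology.IsBounded {x : Fin d → ℝ | ∀ j, 0 ≤ eval x (a j)})
    (f : MvPolynomial (Fin d) ℝ)
    (hf : ∀ x : Fin d → ℝ, (∀ j, 0 ≤ eval x (a j)) → 0 < eval x f) :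
    f ∈ Preordering a := by
  obtain ⟨s, hs, t, ht, e⟩ := wpss a f hf
  refine final_step (preordering_preCone a) (woermann a hbdd) f t ht ?_
  rw [e, add_sub_cancel_left]
  exact hs
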